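/- arXiv:0810.5362 — 6 statements merged into one kernel-verified Lean document; each statement's English description precedes it below -/
import Mathlib

section
/- On the GCM graph of type A_n with n ≥ 2, let (a_1,…,a_n) be a strongly dominant position. Then the concatenated firing sequence (s_n, s_{n−1}, …, s_2), where s_i = (i, i+1, …, n−1, n) for 2 ≤ i ≤ n, is a legal firing sequence from (a_1,…,a_n), and the resulting position assigns a_1 + a_2 + ⋯ + a_n to node 1 and −a_{n+2−j} to node j for 2 ≤ j ≤ n; that is, the resulting position is (a_1+⋯+a_n, −a_n, −a_{n−1}, …, −a_3, −a_2). -/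
/-- Firing node `i` transforms the position `lam` by `lam j ↦ lam j - M i j * lam i`. -/
def fire (M : ℕ → ℕ → ℤ) (lam : ℕ → ℝ) (i : ℕ) : ℕ → ℝ :=
  fun j => lam j - (M i j : ℝ) * lam i

/-- The position obtained from `lam` by firing the nodes of a list in order. -/
def fireList (M : ℕ → ℕ → ℤ) : (ℕ → ℝ) → List ℕ → (ℕ → ℝ)
  | lam, [] => lam
  | lam, i :: s => fireList M (fire M lam i) s

/-- A list of node firings is legal from `lam` (on the graph with node set `{1,…,n}`)
if each fired node is a node of the graph carrying a positive number at the time of firing. -/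
def LegalSeq (n : ℕ) (M : ℕ → ℕ → ℤ) : (ℕ → ℝ) → List ℕ → Prop
  | _, [] => True
  | lam, i :: s => 1 ≤ i ∧ i ≤ n ∧ 0 < lam i ∧ LegalSeq n M (fire M lam i) s

/-- The GCM of type `A n` on nodes `{1,…,n}` (extended by zero off the node set). -/
def MtypeA (n : ℕ) : ℕ → ℕ → ℤ := fun i j =>
  if i = j then 2
  else if 1 ≤ i ∧ i ≤ n ∧ 1 ≤ j ∧ j ≤ n ∧ (i + 1 = j ∨ j + 1 = i) then -1
  else 0

/-- The GCM of type `B n` on nodes `{1,…,n}`: as type `A n` except `M (n-1) n = -2`. -/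
def MtypeB (n : ℕ) : ℕ → ℕ → ℤ := fun i j =>
  if i = j then 2
  else if 1 ≤ i ∧ i + 1 = j ∧ j ≤ n then (if j = n then -2 else -1)
  else if 1 ≤ j ∧ j + 1 = i ∧ i ≤ n then -1
  else 0

/-- The GCM of type `C n` on nodes `{1,…,n}`: as type `A n` except `M n (n-1) = -2`. -/
def MtypeC (n : ℕ) : ℕ → ℕ → ℤ := fun i j =>
  if i = j then 2
  else if 1 ≤ i ∧ i + 1 = j ∧ j ≤ n then -1
  else if 1 ≤ j ∧ j + 1 = i ∧ i ≤ n then (if i = n then -2 else -1)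
  else 0

/-- The GCM of type `D n` on nodes `{1,…,n}`: a path `1,…,n-1` together with the
edge `{n-2, n}`, all amplitudes `-1`. -/
def MtypeD (n : ℕ) : ℕ → ℕ → ℤ := fun i j =>
  if i = j then 2
  else if (1 ≤ i ∧ i + 1 = j ∧ j ≤ n - 1) ∨ (1 ≤ j ∧ j + 1 = i ∧ i ≤ n - 1) then -1
  else if (i = n - 2 ∧ j = n) ∨ (j = n - 2 ∧ i = n) then -1
  else 0

/-- The firing sequence `(s_n, s_{n-1}, …, s_2)` of Lemma 2.1.A, where
`s_i = (i, i+1, …, n-1, n)`. -/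
def seqA2 (n : ℕ) : List ℕ :=
  ((List.range' 2 (n - 1)).reverse).flatMap fun i => List.range' i (n + 1 - i)

/-- The numbers of `lam` on the nodes `1, …, n` are the consecutive differences of `x`. -/
def IsDiffOn (n : ℕ) (lam x : ℕ → ℝ) : Prop :=
  ∀ j, 1 ≤ j → j ≤ n → lam j = x (j + 1) - x j

/-- The firing sequence `(s_n, …, s_i)` with `s_k = (k, …, n)`, where `m = n + 1 - i`. -/
def tailSeq (n i m : ℕ) : List ℕ :=
  ((List.range' i m).reverse).flatMap fun k => List.range' k (n + 1 - k)

theorem IsDiffOn.congr {n : ℕ} {lam x y : ℕ → ℝ} (h : IsDiffOn n lam x)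
    (hxy : ∀ j, 1 ≤ j → j ≤ n + 1 → x j = y j) : IsDiffOn n lam y := by
  intro j h1 h2
  rw [h j h1 h2, hxy j h1 (by omega), hxy (j + 1) (by omega) (by omega)]

/-- Firing node `i` of type `A n` exchanges the entries `i` and `i + 1` of the partial sums. -/
theorem IsDiffOn.fire {n : ℕ} {lam x : ℕ → ℝ} (h : IsDiffOn n lam x) {i : ℕ}
    (hi : 1 ≤ i) (hin : i ≤ n) :
    IsDiffOn n (fire (MtypeA n) lam i) (fun j => x (Equiv.swap i (i + 1) j)) := by
  intro j h1 h2
  simp only [_root_.fire, MtypeA, Equiv.swap_apply_def]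
  rw [h j h1 h2, h i hi hin]
  rcases lt_trichotomy j i with hj | rfl | hj
  · by_cases hj' : j + 1 = i
    · subst hj'
      rw [if_neg (by omega : j ≠ j + 1 + 1)]
      simp [hin, h1, h2]
    · rw [if_neg (by omega), if_neg (by omega), if_neg (by omega), if_neg (by omega),
        if_neg (by omega), if_neg (by omega)]
      simp
  · simp
    ring
  · by_cases hj' : j = i + 1
    · subst hj'
      rw [if_neg (by omega : i + 1 + 1 ≠ i)]
      simp [hi, hin, h2]
    · rw [if_neg (by omega), if_neg (by omega), if_neg (by omega), if_neg (by omega),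
        if_neg (by omega), if_neg (by omega)]
      simp

theorem fireList_append (M : ℕ → ℕ → ℤ) (lam : ℕ → ℝ) (s t : List ℕ) :
    fireList M lam (s ++ t) = fireList M (fireList M lam s) t := by
  induction s generalizing lam with
  | nil => rfl
  | cons i s ih => exact ih _

theorem LegalSeq.append {n : ℕ} {M : ℕ → ℕ → ℤ} {lam : ℕ → ℝ} {s t : List ℕ}
    (hs : LegalSeq n M lam s) (ht : LegalSeq n M (fireList M lam s) t) :
    LegalSeq n M lam (s ++ t) := by
  induction s generalizing lam with
  | nil => exact ht
  | cons i s ih => exact ⟨hs.1, hs.2.1, hs.2.2.1, ih hs.2.2.2 ht⟩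

/-- Firing `(i, …, n)` moves the entry `x i` of the partial sums to the end. -/
theorem IsDiffOn.fireList_range' {n m i : ℕ} {lam x : ℕ → ℝ} (h : IsDiffOn n lam x)
    (hi : 1 ≤ i) (him : i + m = n + 1) (hx : ∀ k, i < k → k ≤ n + 1 → x i < x k) :
    LegalSeq n (MtypeA n) lam (List.range' i m) ∧
    IsDiffOn n (fireList (MtypeA n) lam (List.range' i m))
      (fun j => if j < i then x j else if j ≤ n then x (j + 1) else x i) := by
  induction m generalizing i lam x with
  | zero =>
    refine ⟨trivial, h.congr fun j h1 h2 => ?_⟩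
    split_ifs
    · rfl
    · omega
    · congr 1
      omega
  | succ m ih =>
    obtain ⟨hlegal, hdiff⟩ := ih (i := i + 1) (h.fire hi (by omega)) (by omega) (by omega) (by
      intro k h1 h2
      rw [Equiv.swap_apply_right, Equiv.swap_apply_of_ne_of_ne (by omega) (by omega)]
      exact hx k (by omega) h2)
    refine ⟨⟨hi, by omega, ?_, hlegal⟩, hdiff.congr fun j h1 h2 => ?_⟩
    · rw [h i hi (by omega)]
      exact sub_pos.mpr (hx (i + 1) (by omega) (by omega))
    · rcases lt_trichotomy j i with hj | rfl | hj
      · rw [if_pos (by omega), if_pos hj, Equiv.swap_apply_of_ne_of_ne (by omega) (by omega)]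
      · rw [if_pos (by omega), if_neg (by omega), if_pos (by omega), Equiv.swap_apply_left]
      · rw [if_neg (by omega : ¬j < i + 1), if_neg (by omega : ¬j < i), Equiv.swap_apply_right,
          Equiv.swap_apply_of_ne_of_ne (by omega) (by omega)]

/-- Firing `(s_n, …, s_i)` reverses the entries `i, …, n + 1` of the partial sums. -/
theorem IsDiffOn.fireList_tailSeq {n m i : ℕ} {lam x : ℕ → ℝ} (h : IsDiffOn n lam x)
    (hi : 1 ≤ i) (him : i + m = n + 1)
    (hx : ∀ j k, 1 ≤ j → j < k → k ≤ n + 1 → x j < x k) :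
    LegalSeq n (MtypeA n) lam (tailSeq n i m) ∧
    IsDiffOn n (fireList (MtypeA n) lam (tailSeq n i m))
      (fun j => if j < i then x j else x (n + 1 + i - j)) := by
  induction m generalizing i with
  | zero =>
    refine ⟨trivial, h.congr fun j h1 h2 => ?_⟩
    split_ifs
    · rfl
    · congr 1
      omega
  | succ m ih =>
    obtain ⟨hlegal, hdiff⟩ := ih (i := i + 1) (by omega) (by omega)
    have hseq : tailSeq n i (m + 1) = tailSeq n (i + 1) m ++ List.range' i (n + 1 - i) := by
      simp [tailSeq, List.range'_succ]
    obtain ⟨hlegal', hdiff'⟩ := hdiff.fireList_range' (m := n + 1 - i) hi (by omega) (by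
      intro k h1 h2
      rw [if_pos (by omega), if_neg (by omega)]
      exact hx _ _ hi (by omega) (by omega))
    rw [hseq, fireList_append]
    refine ⟨hlegal.append hlegal', hdiff'.congr fun j h1 h2 => ?_⟩
    split_ifs <;> first | rfl | omega | (congr 1; omega)

/-- On type `A n` (`n ≥ 2`), from a strongly dominant position `(a 1, …, a n)` the
firing sequence `(s_n, …, s_2)` with `s_i = (i, i+1, …, n)` is legal and yields the
position `(a 1 + ⋯ + a n, -a n, -a (n-1), …, -a 3, -a 2)`. -/
theorem typeA_from2 (n : ℕ) (hn : 2 ≤ n) (a : ℕ → ℝ)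
    (ha : ∀ i, 1 ≤ i → i ≤ n → 0 < a i) :
    LegalSeq n (MtypeA n) a (seqA2 n) ∧
    fireList (MtypeA n) a (seqA2 n) 1 = ∑ k ∈ Finset.Icc 1 n, a k ∧
    ∀ j, 2 ≤ j → j ≤ n → fireList (MtypeA n) a (seqA2 n) j = -(a (n + 2 - j)) := by
  have hdiff : IsDiffOn n a (fun j => ∑ k ∈ Finset.range j, a k) := by
    intro j _ _
    simp [Finset.sum_range_succ]
  have hmono : ∀ j k, 1 ≤ j → j < k → k ≤ n + 1 →
      ∑ l ∈ Finset.range j, a l < ∑ l ∈ Finset.range k, a l := by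
    intro j k h1 h2 h3
    rw [← sub_pos, ← Finset.sum_Ico_eq_sub _ h2.le]
    refine Finset.sum_pos (fun l hl => ?_) (Finset.nonempty_Ico.mpr h2)
    rw [Finset.mem_Ico] at hl
    exact ha l (by omega) (by omega)
  obtain ⟨hlegal, hfinal⟩ :=
    hdiff.fireList_tailSeq (i := 2) (m := n - 1) (by omega) (by omega) hmono
  refine ⟨hlegal, (hfinal 1 le_rfl (by omega)).trans ?_, fun j h1 h2 =>
    (hfinal j (by omega) h2).trans ?_⟩
  · dsimp only
    rw [if_neg (by omega), if_pos (by omega), ← Finset.sum_Ico_eq_sub _ (by omega)]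
    rfl
  · dsimp only
    rw [if_neg (by omega), if_neg (by omega),
      show n + 1 + 2 - j = n + 2 - j + 1 by omega,
      show n + 1 + 2 - (j + 1) = n + 2 - j by omega, Finset.sum_range_succ]
    ring
end

section
/- On the GCM graph of type C_n with n ≥ 3, let (a_1,…,a_n) be a strongly dominant position. Then the concatenated firing sequence (s_n, s_{n−1}, …, s_2), where s_i = (i, i+1, …, n−1, n, n−1, …, i+1, i) for 2 ≤ i ≤ n−1 and s_n = (n), is a legal firing sequence from (a_1,…,a_n), and the resulting position is (a_1 + 2a_2 + ⋯ + 2a_{n−1} + 2a_n, −a_2, −a_3, …, −a_n); that is, node 1 receives a_1 + 2·(a_2 + ⋯ + a_n) and node j receives −a_j for 2 ≤ j ≤ n. -/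
/-- The firing sequence `(s_n, s_{n-1}, …, s_2)` of Lemma 2.1.C, where
`s_i = (i, i+1, …, n-1, n, n-1, …, i+1, i)` for `2 ≤ i ≤ n-1` and `s_n = (n)`. -/
def seqBC2 (n : ℕ) : List ℕ :=
  ((List.range' 2 (n - 1)).reverse).flatMap fun i =>
    List.range' i (n + 1 - i) ++ (List.range' i (n - i)).reverse

theorem legalSeq_append (n : ℕ) (M : ℕ → ℕ → ℤ) (lam : ℕ → ℝ) (s t : List ℕ) :
    LegalSeq n M lam (s ++ t) ↔ LegalSeq n M lam s ∧ LegalSeq n M (fireList M lam s) t := by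
  induction s generalizing lam with
  | nil => simp [LegalSeq, fireList]
  | cons i s ih => simp [LegalSeq, fireList, ih, and_assoc]

/-- The position with orthogonal coordinates `x`: `x j - x (j + 1)` at each node `j < n`,
and `x n` at node `n`. In these coordinates the firings of type `C n` act by signed permutations. -/
def posOfCoords (n : ℕ) (x : ℕ → ℝ) : ℕ → ℝ :=
  fun j => if j < n then x j - x (j + 1) else x j

theorem fire_posOfCoords_of_lt {n i : ℕ} (hi : 2 ≤ i) (hin : i < n) (x : ℕ → ℝ) :
    fire (MtypeC n) (posOfCoords n x) i
      = posOfCoords n (Function.update (Function.update x i (x (i + 1))) (i + 1) (x i)) := by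
  funext j
  simp only [fire, MtypeC, posOfCoords, Function.update_apply]
  push_cast
  grind

theorem fire_posOfCoords_self {n : ℕ} (hn : 2 ≤ n) (x : ℕ → ℝ) :
    fire (MtypeC n) (posOfCoords n x) n = posOfCoords n (Function.update x n (-x n)) := by
  funext j
  simp only [fire, MtypeC, posOfCoords, Function.update_apply]
  push_cast
  grind

/-- The sequence `(i, …, n - 1, n, n - 1, …, i)`, where `n = i + d`, negates the `i`-th
coordinate. -/
theorem palindrome_posOfCoords (n d i : ℕ) (x : ℕ → ℝ) (hi : 2 ≤ i) (hd : i + d = n)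
    (hpos : 0 < x i) (hlt : ∀ j, i < j → j ≤ n → |x j| < x i) :
    LegalSeq n (MtypeC n) (posOfCoords n x)
        (List.range' i (d + 1) ++ (List.range' i d).reverse) ∧
      fireList (MtypeC n) (posOfCoords n x)
        (List.range' i (d + 1) ++ (List.range' i d).reverse)
        = posOfCoords n (Function.update x i (-x i)) := by
  induction d generalizing i x with
  | zero =>
    obtain rfl : i = n := by omega
    simp only [List.range'_succ, List.range'_zero, List.reverse_nil, List.append_nil, LegalSeq,
      fireList, fire_posOfCoords_self hi, and_true]
    exact ⟨by omega, le_rfl, by simpa [posOfCoords] using hpos⟩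
  | succ d ih =>
    have hin : i < n := by omega
    have habs := abs_lt.1 (hlt (i + 1) (by omega) (by omega))
    have hsplit : List.range' i (d + 1 + 1) ++ (List.range' i (d + 1)).reverse
        = i :: ((List.range' (i + 1) (d + 1) ++ (List.range' (i + 1) d).reverse) ++ [i]) := by
      rw [List.range'_succ (n := d + 1), List.range'_succ (s := i) (n := d)]
      simp
    obtain ⟨hlegal, hfire⟩ := ih (i + 1)
      (Function.update (Function.update x i (x (i + 1))) (i + 1) (x i)) (by omega) (by omega)
      (by simpa using hpos) (fun j hj hjn => by
        simpa [Function.update_apply, show j ≠ i + 1 by omega, show j ≠ i by omega]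
          using hlt j (by omega) hjn)
    rw [hsplit]
    generalize List.range' (i + 1) (d + 1) ++ (List.range' (i + 1) d).reverse = s at hlegal hfire ⊢
    simp only [LegalSeq, fireList, fire_posOfCoords_of_lt hi hin, legalSeq_append,
      fireList_append, hfire]
    refine ⟨⟨by omega, hin.le, ?_, hlegal, by omega, hin.le, ?_, trivial⟩, ?_⟩
    · simp only [posOfCoords, hin, if_true]
      linarith
    · simp only [posOfCoords, hin, if_true, Function.update_apply]
      simp
      linarith
    · congr 1
      funext j
      simp only [Function.update_apply]
      grind

/-- The concatenation `(s_n, …, s_m)` of palindromic sequences, where `m + d = n + 1`, negates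
the coordinates `m, …, n`. -/
theorem flatMap_palindrome_posOfCoords (n d m : ℕ) (x : ℕ → ℝ) (hm : 2 ≤ m) (hd : m + d = n + 1)
    (hpos : ∀ j, m ≤ j → j ≤ n → 0 < x j)
    (hlt : ∀ i j, m ≤ i → i < j → j ≤ n → x j < x i) :
    LegalSeq n (MtypeC n) (posOfCoords n x) ((List.range' m d).reverse.flatMap fun i =>
        List.range' i (n + 1 - i) ++ (List.range' i (n - i)).reverse) ∧
      fireList (MtypeC n) (posOfCoords n x) ((List.range' m d).reverse.flatMap fun i =>
        List.range' i (n + 1 - i) ++ (List.range' i (n - i)).reverse)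
        = posOfCoords n (fun j => if m ≤ j ∧ j ≤ n then -x j else x j) := by
  induction d generalizing m with
  | zero =>
    simp only [List.range'_zero, List.reverse_nil, List.flatMap_nil, LegalSeq, fireList, true_and]
    congr 1
    funext j
    rw [if_neg (by omega)]
  | succ d ih =>
    obtain ⟨hlegal, hfire⟩ := ih (m + 1) (by omega) (by omega)
      (fun j hj hjn => hpos j (by omega) hjn)
      (fun i j hi hij hjn => hlt i j (by omega) hij hjn)
    obtain ⟨hlegal', hfire'⟩ := palindrome_posOfCoords n d m
      (fun j => if m + 1 ≤ j ∧ j ≤ n then -x j else x j) hm (by omega)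
      (by simpa using hpos m le_rfl (by omega))
      (fun j hj hjn => by
        simpa [show m + 1 ≤ j by omega, hjn, abs_of_pos (hpos j hj.le hjn)]
          using hlt m j le_rfl hj hjn)
    simp only [List.range'_succ (s := m) (n := d), List.reverse_cons, List.flatMap_append,
      List.flatMap_singleton, legalSeq_append n (MtypeC n) (posOfCoords n x),
      fireList_append (MtypeC n) (posOfCoords n x), hfire,
      show n + 1 - m = d + 1 by omega, show n - m = d by omega]
    refine ⟨⟨hlegal, hlegal'⟩, hfire'.trans ?_⟩
    congr 1
    funext j
    simp only [Function.update_apply]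
    grind

/-- Every position has orthogonal coordinates, given on the nodes by tail sums. -/
theorem posOfCoords_sum_Icc (n : ℕ) (a : ℕ → ℝ) :
    posOfCoords n (fun j => if j ≤ n then ∑ k ∈ Finset.Icc j n, a k else a j) = a := by
  funext j
  rcases lt_trichotomy j n with h | rfl | h
  · simp [posOfCoords, h, h.le, Nat.succ_le_of_lt h, ← Finset.add_sum_Ioc_eq_sum_Icc h.le,
      ← Finset.Icc_add_one_left_eq_Ioc]
  · simp [posOfCoords]
  · simp [posOfCoords, h.not_ge, h.not_gt]

/-- On type `C n` (`n ≥ 3`), from a strongly dominant position `(a 1, …, a n)` the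
firing sequence `(s_n, …, s_2)` is legal and yields the position
`(a 1 + 2 a 2 + ⋯ + 2 a (n-1) + 2 a n, -a 2, -a 3, …, -a n)`. -/
theorem typeC_from2 (n : ℕ) (hn : 3 ≤ n) (a : ℕ → ℝ)
    (ha : ∀ i, 1 ≤ i → i ≤ n → 0 < a i) :
    LegalSeq n (MtypeC n) a (seqBC2 n) ∧
    fireList (MtypeC n) a (seqBC2 n) 1
      = a 1 + 2 * ∑ k ∈ Finset.Icc 2 n, a k ∧
    ∀ j, 2 ≤ j → j ≤ n → fireList (MtypeC n) a (seqBC2 n) j = -(a j) := by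
  obtain ⟨x, hx⟩ : ∃ x : ℕ → ℝ,
      x = fun j => if j ≤ n then ∑ k ∈ Finset.Icc j n, a k else a j := ⟨_, rfl⟩
  have hxa : posOfCoords n x = a := hx ▸ posOfCoords_sum_Icc n a
  have hlast : x n = a n := by simp [hx]
  have hstep (j : ℕ) (hj : j < n) : x j - x (j + 1) = a j := by
    rw [← hxa, posOfCoords, if_pos hj]
  have hpos (j : ℕ) (hj : 2 ≤ j) (hjn : j ≤ n) : 0 < x j := by
    rw [hx]
    simp only [hjn, if_true]
    refine Finset.sum_pos (fun k hk => ?_) (Finset.nonempty_Icc.2 hjn)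
    rw [Finset.mem_Icc] at hk
    exact ha k (by omega) hk.2
  have hlt (i j : ℕ) (hi : 2 ≤ i) (hij : i < j) (hjn : j ≤ n) : x j < x i := by
    induction j, hij using Nat.le_induction with
    | base => linarith [hstep i (by omega), ha i (by omega) (by omega)]
    | succ j hij ih =>
      rw [Nat.succ_le_iff] at hij
      linarith [ih (by omega), hstep j (by omega), ha j (by omega) (by omega)]
  obtain ⟨hlegal, hfire⟩ :=
    flatMap_palindrome_posOfCoords n (n - 1) 2 x le_rfl (by omega) hpos hlt
  rw [hxa] at hlegal hfire
  rw [seqBC2, hfire]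
  refine ⟨hlegal, ?_, fun j hj hjn => ?_⟩
  · have hsum : x 2 = ∑ k ∈ Finset.Icc 2 n, a k := by simp [hx, show 2 ≤ n by omega]
    simp only [posOfCoords, show 1 < n by omega, show 2 ≤ n by omega, if_true, Nat.reduceAdd,
      Nat.reduceLeDiff, false_and, if_false, le_refl, and_self]
    linarith [hstep 1 (by omega)]
  · rcases hjn.lt_or_eq with h | rfl
    · simp only [posOfCoords, h, hj, h.le, show 2 ≤ j + 1 by omega, Nat.succ_le_of_lt h, and_self,
        if_true]
      linarith [hstep j h]
    · simp [posOfCoords, hj, hlast]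
end

section
/- On the GCM graph of type D_n with n ≥ 4, let (a_1,…,a_n) be a strongly dominant position. Set b_{n−1} = a_{n−1} and b_n = a_n when n is odd, and b_{n−1} = a_n and b_n = a_{n−1} when n is even. Then the concatenated firing sequence (s_{n−1}, s_{n−2}, …, s_2), where s_i = (i, i+1, …, n−2, n−1, n, n−2, …, i+1, i) for 2 ≤ i ≤ n−2 and s_{n−1} = (n−1, n), is a legal firing sequence from (a_1,…,a_n), and the resulting position is (a_1 + 2a_2 + ⋯ + 2a_{n−2} + a_{n−1} + a_n, −a_2, −a_3, …, −a_{n−2}, −b_{n−1}, −b_n). -/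
/-- The firing sequence `(s_{n-1}, s_{n-2}, …, s_2)` of Lemma 2.1.D, where
`s_i = (i, i+1, …, n-2, n-1, n, n-2, …, i+1, i)` for `2 ≤ i ≤ n-2` and
`s_{n-1} = (n-1, n)`. -/
def seqD2 (n : ℕ) : List ℕ :=
  ((List.range' 2 (n - 2)).reverse).flatMap fun i =>
    List.range' i (n + 1 - i) ++ (List.range' i (n - 1 - i)).reverse

/-- The simple-root coordinates of type `D n` of a vector `x` in the orthogonal coordinates. -/
noncomputable def dCoord (n : ℕ) (x : ℕ → ℝ) (j : ℕ) : ℝ :=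
  if j = n then x (n - 1) + x n else x j - x (j + 1)

/-- The `i`-th simple reflection of type `D n` in the orthogonal coordinates. -/
noncomputable def dReflect (n i : ℕ) (x : ℕ → ℝ) (j : ℕ) : ℝ :=
  if i = n then (if j = n - 1 then -x n else if j = n then -x (n - 1) else x j)
  else (if j = i then x (i + 1) else if j = i + 1 then x i else x j)

/-- The list `s` is legal from `lam`, and the resulting position has orthogonal coordinates `x`. -/
def LeadsTo (n : ℕ) (lam : ℕ → ℝ) (s : List ℕ) (x : ℕ → ℝ) : Prop :=
  LegalSeq n (MtypeD n) lam s ∧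
    ∀ j, 1 ≤ j → j ≤ n → fireList (MtypeD n) lam s j = dCoord n x j

theorem fireList_append_singleton (M : ℕ → ℕ → ℤ) (lam : ℕ → ℝ) (s : List ℕ) (i : ℕ) :
    fireList M lam (s ++ [i]) = fire M (fireList M lam s) i := by
  induction s generalizing lam with
  | nil => rfl
  | cons a s ih => exact ih _

theorem legalSeq_append_singleton (n : ℕ) (M : ℕ → ℕ → ℤ) (lam : ℕ → ℝ) (s : List ℕ) (i : ℕ)
    (h : LegalSeq n M lam s) (hi : 1 ≤ i) (hin : i ≤ n) (hpos : 0 < fireList M lam s i) :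
    LegalSeq n M lam (s ++ [i]) := by
  induction s generalizing lam with
  | nil => exact ⟨hi, hin, hpos, trivial⟩
  | cons a s ih => exact ⟨h.1, h.2.1, h.2.2.1, ih _ h.2.2.2 hpos⟩

/-- In orthogonal coordinates, firing is a simple reflection. -/
theorem dCoord_dReflect {n i j : ℕ} (hn : 4 ≤ n) (x : ℕ → ℝ) (hi : 1 ≤ i) (hin : i ≤ n)
    (hj : 1 ≤ j) (hjn : j ≤ n) :
    dCoord n (dReflect n i x) j = dCoord n x j - (MtypeD n i j : ℝ) * dCoord n x i := by
  obtain ⟨m, rfl⟩ : ∃ m, n = m + 4 := ⟨n - 4, by omega⟩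
  have e1 : m + 4 - 1 = m + 3 := rfl
  have e2 : m + 4 - 2 = m + 2 := rfl
  simp only [dCoord, dReflect, MtypeD, e1, e2]
  rcases eq_or_ne i (m + 4) with rfl | hi4
  · rcases (by omega : j = m + 4 ∨ j = m + 3 ∨ j = m + 2 ∨ j < m + 2) with rfl | rfl | rfl | h
    · simp; ring
    · simp; ring
    · simp; ring
    · have h1 : j ≠ m + 4 := by omega
      have h2 : j ≠ m + 3 := by omega
      have h3 : j ≠ m + 2 := by omega
      have h4 : m + 4 ≠ j := by omega
      have h5 : m + 5 ≠ j := by omega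
      simp [h1, h2, h3, h4, h5]
  · rcases eq_or_ne j (m + 4) with rfl | hj4
    · rcases (by omega : i = m + 3 ∨ i = m + 2 ∨ i < m + 2) with rfl | rfl | h
      · simp; ring
      · simp; ring
      · have h1 : m + 4 ≠ i := by omega
        have h2 : m + 3 ≠ i := by omega
        have h3 : m + 3 ≠ i + 1 := by omega
        have h4 : m + 4 ≠ i + 1 := by omega
        have h5 : m + 5 ≠ i := by omega
        have h6 : i ≠ m + 2 := by omega
        simp [h1.symm, h1, h2, h3, h4, h5, h6]
    · rcases (by omega : j = i ∨ j = i + 1 ∨ i = j + 1 ∨ (j ≠ i ∧ j ≠ i + 1 ∧ i ≠ j + 1))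
        with rfl | rfl | rfl | ⟨h1, h2, h3⟩
      · simp [hi4]; ring
      · have h : i + 1 ≤ m + 3 := by omega
        have h' : i ≠ m + 3 := by omega
        have h'' : i + 1 + 1 ≠ i := by omega
        simp [hi4, h', h'', hi, h]
      · have h : j + 1 ≤ m + 3 := by omega
        have h' : j ≠ m + 3 := by omega
        have h'' : j ≠ j + 1 + 1 := by omega
        simp [h', h'', hj4, hj, h]
      · have h4 : j + 1 ≠ i := h3.symm
        simp [hi4, hj4, h1, h1.symm, h2, h2.symm, h4]

theorem LeadsTo.fire {n i : ℕ} {lam x y : ℕ → ℝ} {s : List ℕ} (hn : 4 ≤ n)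
    (h : LeadsTo n lam s x) (hi : 1 ≤ i) (hin : i ≤ n) (hpos : 0 < dCoord n x i)
    (hy : y = dReflect n i x) : LeadsTo n lam (s ++ [i]) y := by
  subst hy
  refine ⟨legalSeq_append_singleton _ _ _ _ _ h.1 hi hin (by rwa [h.2 i hi hin]), ?_⟩
  intro j hj hjn
  rw [fireList_append_singleton, dCoord_dReflect hn x hi hin hj hjn, ← h.2 j hj hjn,
    ← h.2 i hi hin]
  rfl

/-- Firing `i, …, i + k - 1` moves the `i`-th coordinate to place `i + k`. -/
theorem LeadsTo.ascend {n i : ℕ} {lam x : ℕ → ℝ} {s : List ℕ} (hn : 4 ≤ n)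
    (h : LeadsTo n lam s x) (hi : 1 ≤ i) (k : ℕ) (hk : i + k ≤ n)
    (hlt : ∀ j, i < j → j ≤ i + k → x j < x i) :
    LeadsTo n lam (s ++ List.range' i k)
      (fun j => if i ≤ j ∧ j < i + k then x (j + 1) else if j = i + k then x i else x j) := by
  induction k with
  | zero =>
    convert h using 1
    · simp
    · funext j
      split_ifs <;> first | rfl | omega | (congr 1; omega)
  | succ k ih =>
    have h' := ih (by omega) fun j h₁ h₂ => hlt j h₁ (by omega)
    rw [List.range'_concat, ← List.append_assoc, one_mul]
    refine h'.fire hn (by omega) (by omega) ?_ ?_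
    · have := hlt (i + k + 1) (by omega) (by omega)
      simp [dCoord, show i + k ≠ n by omega]
      linarith
    · funext j
      unfold dReflect
      beta_reduce
      split_ifs <;> first | rfl | omega | (congr 1; omega)

/-- Firing `i + k - 1, …, i` moves the coordinate at place `i + k` to place `i`. -/
theorem LeadsTo.descend {n i : ℕ} {lam x : ℕ → ℝ} {s : List ℕ} (hn : 4 ≤ n)
    (h : LeadsTo n lam s x) (hi : 1 ≤ i) (k : ℕ) (hk : i + k ≤ n)
    (hlt : ∀ j, i ≤ j → j < i + k → x (i + k) < x j) :
    LeadsTo n lam (s ++ (List.range' i k).reverse)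
      (fun j => if j = i then x (i + k) else if i < j ∧ j ≤ i + k then x (j - 1) else x j) := by
  induction k generalizing i with
  | zero =>
    convert h using 1
    · simp
    · funext j
      split_ifs <;> first | rfl | omega | (congr 1; omega)
  | succ k ih =>
    have h' := ih (i := i + 1) (by omega) (by omega) fun j h₁ h₂ => by
      have := hlt j (by omega) (by omega)
      rwa [show i + (k + 1) = i + 1 + k by omega] at this
    rw [List.range'_succ, List.reverse_cons, ← List.append_assoc]
    refine h'.fire hn (by omega) (by omega) ?_ ?_
    · have := hlt i (by omega) (by omega)
      rw [show i + (k + 1) = i + 1 + k by omega] at this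
      simp [dCoord, show i ≠ n by omega]
      linarith
    · funext j
      unfold dReflect
      beta_reduce
      split_ifs <;> first | rfl | omega | (congr 1; omega)

/-- The block `i, …, n, n - 2, …, i` negates the coordinates `i` and `n`. -/
theorem LeadsTo.block {n i : ℕ} {lam x : ℕ → ℝ} {s : List ℕ} (hn : 4 ≤ n)
    (h : LeadsTo n lam s x) (hi : 1 ≤ i) (hin : i < n)
    (hlt : ∀ j, i < j → j ≤ n → |x j| < x i) :
    LeadsTo n lam (s ++ (List.range' i (n + 1 - i) ++ (List.range' i (n - 1 - i)).reverse))
      (fun j => if j = i ∨ j = n then -x j else x j) := by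
  have h₁ := h.ascend hn hi (n - i) (by omega)
    fun j hij hj => (le_abs_self _).trans_lt (hlt j hij (by omega))
  have h₂ := h₁.fire hn (i := n) (by omega) le_rfl (by
    have := (neg_abs_le (x n)).trans_lt' (neg_lt_neg (hlt n hin le_rfl))
    have e : i + (n - i) = n := by omega
    simp only [dCoord, e, if_true]
    rw [if_pos (by omega), if_neg (by omega), show n - 1 + 1 = n by omega]
    linarith) rfl
  have h₃ := h₂.descend hn hi (n - 1 - i) (by omega) (by
    intro j hij hj
    have := (neg_abs_le (x (j + 1))).trans_lt' (neg_lt_neg (hlt (j + 1) (by omega) (by omega)))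
    have e : i + (n - 1 - i) = n - 1 := by omega
    have e' : i + (n - i) = n := by omega
    simp only [dReflect, e, e']
    simp only [if_true]
    rw [if_neg (by omega), if_neg (by omega), if_neg (by omega), if_pos (by omega)]
    exact this)
  convert h₃ using 1
  · rw [show n + 1 - i = (n - i) + 1 by omega, List.range'_concat, one_mul,
      show i + (n - i) = n by omega]
    simp only [List.append_assoc]
  · funext j
    rw [show i + (n - 1 - i) = n - 1 by omega, show i + (n - i) = n by omega]
    simp only [dReflect, if_true]
    grind

theorem LeadsTo.blocks {n : ℕ} {a x : ℕ → ℝ} (hn : 4 ≤ n) (h : LeadsTo n a [] x)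
    (hlt : ∀ i j, 1 ≤ i → i < j → j ≤ n → |x j| < x i) (k : ℕ) (hk : k < n) :
    LeadsTo n a ((List.range' (n - k) k).reverse.flatMap fun i =>
        List.range' i (n + 1 - i) ++ (List.range' i (n - 1 - i)).reverse)
      (fun j => if j = n then (-1) ^ k * x n else if n - k ≤ j ∧ j < n then -x j else x j) := by
  induction k with
  | zero =>
    convert h using 1
    · simp
    · funext j
      split_ifs with h₁ <;> first | omega | simp [h₁]
  | succ k ih =>
    have h' := (ih (by omega)).block hn (i := n - (k + 1)) (by omega) (by omega) (by
      intro j hij hj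
      have := hlt _ j (by omega) hij hj
      rw [if_neg (show n - (k + 1) ≠ n by omega),
        if_neg (show ¬(n - k ≤ n - (k + 1) ∧ n - (k + 1) < n) by omega)]
      split_ifs with h₁ h₂
      · subst h₁
        simpa [abs_mul] using this
      · simpa using this
      · exact this)
    convert h' using 1
    · rw [List.range'_succ, show n - (k + 1) + 1 = n - k by omega]
      simp
    · funext j
      split_ifs <;> first | rfl | omega | (rw [pow_succ]; ring)

/-- Orthogonal coordinates of the position `a` of type `D n`. -/
noncomputable def dOrth (n : ℕ) (a : ℕ → ℝ) (j : ℕ) : ℝ :=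
  (a n - a (n - 1)) / 2 + ∑ k ∈ Finset.Ico j n, a k

theorem dCoord_dOrth {n j : ℕ} (hn : 4 ≤ n) (a : ℕ → ℝ) (hjn : j ≤ n) :
    dCoord n (dOrth n a) j = a j := by
  unfold dCoord dOrth
  split_ifs with h
  · subst h
    rw [Finset.sum_eq_sum_Ico_succ_bot (by omega : j - 1 < j), show j - 1 + 1 = j by omega]
    simp
    ring
  · rw [Finset.sum_eq_sum_Ico_succ_bot (by omega : j < n)]
    ring

theorem abs_dOrth_lt {n i j : ℕ} (a : ℕ → ℝ)
    (ha : ∀ i, 1 ≤ i → i ≤ n → 0 < a i) (hi : 1 ≤ i) (hij : i < j) (hjn : j ≤ n) :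
    |dOrth n a j| < dOrth n a i := by
  have h₁ : 0 < ∑ k ∈ Finset.Ico i j, a k :=
    Finset.sum_pos (fun k hk => by rw [Finset.mem_Ico] at hk; exact ha k (by omega) (by omega))
      ⟨i, by simp [hij]⟩
  have h₂ := Finset.sum_Ico_consecutive a hij.le hjn
  have h₃ : 0 ≤ ∑ k ∈ Finset.Ico j n, a k :=
    Finset.sum_nonneg fun k hk => by
      rw [Finset.mem_Ico] at hk; exact (ha k (by omega) (by omega)).le
  have h₄ : a (n - 1) ≤ ∑ k ∈ Finset.Ico i n, a k :=
    Finset.single_le_sum (f := a) (fun k hk => by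
      rw [Finset.mem_Ico] at hk; exact (ha k (by omega) (by omega)).le)
      (by rw [Finset.mem_Ico]; omega)
  have h₅ := ha n (by omega) le_rfl
  rw [abs_lt]
  unfold dOrth
  constructor <;> linarith

/-- On type `D n` (`n ≥ 4`), from a strongly dominant position `(a 1, …, a n)` the
firing sequence `(s_{n-1}, …, s_2)` is legal and yields the position
`(a 1 + 2 a 2 + ⋯ + 2 a (n-2) + a (n-1) + a n, -a 2, …, -a (n-2), -b (n-1), -b n)`,
where `b (n-1) = a (n-1)` and `b n = a n` when `n` is odd, and
`b (n-1) = a n` and `b n = a (n-1)` when `n` is even. -/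
theorem typeD_from2 (n : ℕ) (hn : 4 ≤ n) (a : ℕ → ℝ)
    (ha : ∀ i, 1 ≤ i → i ≤ n → 0 < a i) :
    LegalSeq n (MtypeD n) a (seqD2 n) ∧
    fireList (MtypeD n) a (seqD2 n) 1
      = a 1 + a (n - 1) + a n + 2 * ∑ k ∈ Finset.Icc 2 (n - 2), a k ∧
    (∀ j, 2 ≤ j → j ≤ n - 2 → fireList (MtypeD n) a (seqD2 n) j = -(a j)) ∧
    fireList (MtypeD n) a (seqD2 n) (n - 1)
      = -(if n % 2 = 1 then a (n - 1) else a n) ∧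
    fireList (MtypeD n) a (seqD2 n) n
      = -(if n % 2 = 1 then a n else a (n - 1)) := by
  obtain ⟨hlegal, hval⟩ := LeadsTo.blocks hn
    ⟨trivial, fun j _ hj => (dCoord_dOrth hn a hj).symm⟩
    (fun i j => abs_dOrth_lt a ha) (n - 2) (by omega)
  rw [show n - (n - 2) = 2 by omega] at hlegal hval
  change ∀ j, 1 ≤ j → j ≤ n → fireList (MtypeD n) a (seqD2 n) j = _ at hval
  have hpow : (-1 : ℝ) ^ (n - 2) = if n % 2 = 1 then -1 else 1 := by
    split_ifs with h
    · exact Odd.neg_one_pow (Nat.odd_iff.mpr (by omega))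
    · exact Even.neg_one_pow (Nat.even_iff.mpr (by omega))
  have hlast := dCoord_dOrth hn a (le_refl n)
  have hprev := dCoord_dOrth hn a (show n - 1 ≤ n by omega)
  simp only [dCoord, if_true, if_neg (show n - 1 ≠ n by omega),
    show n - 1 + 1 = n by omega] at hlast hprev
  refine ⟨hlegal, ?_, ?_, ?_, ?_⟩
  · rw [hval 1 le_rfl (by omega)]
    simp only [dCoord]
    rw [if_neg (by omega), if_neg (by omega), if_neg (by omega), if_neg (by omega),
      if_pos (by omega)]
    have h₁ : Finset.Icc 2 (n - 2) = Finset.Ico 2 (n - 1) := by ext; simp; omega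
    have h₂ := Finset.sum_Ico_succ_top (show 2 ≤ n - 1 by omega) a
    rw [show n - 1 + 1 = n by omega] at h₂
    rw [h₁]
    simp only [dOrth]
    rw [Finset.sum_eq_sum_Ico_succ_bot (show 1 < n by omega), one_add_one_eq_two, h₂]
    ring
  · intro j hj hjn
    have hcoord := dCoord_dOrth hn a (show j ≤ n by omega)
    simp only [dCoord, if_neg (show j ≠ n by omega)] at hcoord
    rw [hval j (by omega) (by omega)]
    simp only [dCoord]
    rw [if_neg (by omega), if_neg (by omega), if_pos (by omega), if_neg (by omega),
      if_pos (by omega)]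
    linarith
  · rw [hval (n - 1) (by omega) (by omega)]
    simp only [dCoord, hpow, show n - 1 + 1 = n by omega, if_true]
    rw [if_neg (by omega), if_neg (by omega), if_pos (by omega)]
    split_ifs <;> linarith
  · rw [hval n (by omega) le_rfl]
    simp only [dCoord, hpow, if_true]
    rw [if_neg (by omega), if_pos (by omega)]
    split_ifs <;> linarith
end

section
/- On the GCM graph of type C_n with n ≥ 3, let (a_1,…,a_n) be a strongly dominant position. Then the concatenated firing sequence (s_n, s_{n−1}, …, s_1), where s_i = (i, i+1, …, n−1, n, n−1, …, i+1, i) for 1 ≤ i ≤ n−1 and s_n = (n), is a legal firing sequence from (a_1,…,a_n), and the resulting position is (−a_1, −a_2, …, −a_n). -/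
/-- The firing sequence `(s_n, s_{n-1}, …, s_1)` of Lemma 2.2.C, where
`s_i = (i, i+1, …, n-1, n, n-1, …, i+1, i)` for `1 ≤ i ≤ n-1` and `s_n = (n)`. -/
def seqBC1 (n : ℕ) : List ℕ :=
  ((List.range' 1 n).reverse).flatMap fun i =>
    List.range' i (n + 1 - i) ++ (List.range' i (n - i)).reverse

/-- `x` gives the coordinates of the position `lam` in the standard orthogonal realization:
`lam j = x j - x (j + 1)` on the nodes `{1,…,n}`, with `x (n + 1) = 0`. -/
def HasCoords (n : ℕ) (lam x : ℕ → ℝ) : Prop :=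
  x (n + 1) = 0 ∧ ∀ j, 1 ≤ j → j ≤ n → lam j = x j - x (j + 1)

/-- Firing a node `i < n` exchanges the coordinates `i` and `i + 1`. -/
theorem HasCoords.fire_of_lt {n : ℕ} {lam x y : ℕ → ℝ} (h : HasCoords n lam x) {i : ℕ}
    (hi : 1 ≤ i) (hin : i < n) (h₁ : y i = x (i + 1)) (h₂ : y (i + 1) = x i)
    (h₃ : ∀ j, j ≠ i → j ≠ i + 1 → y j = x j) :
    HasCoords n (fire (MtypeC n) lam i) y := by
  refine ⟨by rw [h₃ _ (by omega) (by omega), h.1], fun j hj hjn => ?_⟩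
  have hlam := h.2 i hi hin.le
  have hlam' := h.2 j hj hjn
  unfold fire MtypeC
  by_cases e₁ : i = j
  · subst e₁
    rw [if_pos rfl, h₁, h₂, hlam]
    push_cast
    ring
  · by_cases e₂ : i + 1 = j
    · subst e₂
      rw [if_neg e₁, if_pos ⟨hi, rfl, hjn⟩, h₂, h₃ _ (by omega) (by omega), hlam, hlam']
      push_cast
      ring
    · by_cases e₃ : j + 1 = i
      · subst e₃
        rw [if_neg e₁, if_neg (by omega), if_pos ⟨hj, rfl, hin.le⟩, if_neg hin.ne, h₁,
          h₃ j (by omega) (by omega), hlam, hlam']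
        push_cast
        ring
      · rw [if_neg e₁, if_neg (by omega), if_neg (by omega), h₃ j (by omega) (by omega),
          h₃ (j + 1) (by omega) (by omega), hlam']
        push_cast
        ring

/-- Firing the node `n` negates the coordinate `n`. -/
theorem HasCoords.fire_last {n : ℕ} {lam x : ℕ → ℝ} (h : HasCoords n lam x) (hn : 1 ≤ n) :
    HasCoords n (fire (MtypeC n) lam n) (Function.update x n (-x n)) := by
  refine ⟨by rw [Function.update_of_ne (by omega), h.1], fun j hj hjn => ?_⟩
  have hlam := h.2 n hn le_rfl
  have hlam' := h.2 j hj hjn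
  rw [h.1] at hlam
  unfold fire MtypeC
  by_cases e₁ : n = j
  · subst e₁
    rw [if_pos rfl, Function.update_self, Function.update_of_ne (by omega), h.1, hlam]
    push_cast
    ring
  · rw [if_neg e₁, if_neg (by omega), Function.update_of_ne (Ne.symm e₁), hlam']
    by_cases e₃ : j + 1 = n
    · subst e₃
      rw [if_pos ⟨hj, rfl, le_rfl⟩, if_pos rfl, Function.update_self, hlam]
      push_cast
      ring
    · rw [if_neg (by omega), Function.update_of_ne e₃]
      push_cast
      ring

/-- The palindromic block `(i, i+1, …, n-1, n, n-1, …, i+1, i)`. -/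
def typeCBlock (n i : ℕ) : List ℕ :=
  List.range' i (n + 1 - i) ++ (List.range' i (n - i)).reverse

theorem typeCBlock_self (n : ℕ) : typeCBlock n n = [n] := by
  simp [typeCBlock]

theorem typeCBlock_of_lt {n i : ℕ} (h : i < n) : typeCBlock n i = i :: (typeCBlock n (i + 1) ++ [i]) := by
  obtain ⟨d, rfl⟩ := Nat.exists_eq_add_of_lt h
  have e₁ : i + d + 1 + 1 - i = (d + 1) + 1 := by omega
  have e₂ : i + d + 1 - i = d + 1 := by omega
  have e₃ : i + d + 1 + 1 - (i + 1) = d + 1 := by omega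
  have e₄ : i + d + 1 - (i + 1) = d := by omega
  rw [typeCBlock, typeCBlock, e₁, e₂, e₃, e₄, List.range'_succ (s := i) (n := d + 1), List.range'_succ (s := i) (n := d)]
  simp

/-- If the coordinate `i` exceeds all later ones in absolute value, the block at `i` is legal
and negates it. -/
theorem HasCoords.neg_of_block {n i : ℕ} (hin : i ≤ n) {lam x : ℕ → ℝ} (hi : 1 ≤ i)
    (h : HasCoords n lam x) (hpos : 0 < x i) (hx : ∀ k, i < k → k ≤ n → |x k| < x i) :
    LegalSeq n (MtypeC n) lam (typeCBlock n i) ∧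
      HasCoords n (fireList (MtypeC n) lam (typeCBlock n i)) (Function.update x i (-x i)) := by
  induction hin using Nat.decreasingInduction generalizing lam x with
  | self =>
    rw [typeCBlock_self]
    refine ⟨⟨hi, le_rfl, ?_, trivial⟩, h.fire_last hi⟩
    rw [h.2 n hi le_rfl, h.1]
    linarith
  | of_succ i hin ih =>
    have hx' := abs_lt.1 (hx (i + 1) (by omega) hin)
    set y : ℕ → ℝ := x ∘ Equiv.swap i (i + 1) with hy
    have y₁ : y i = x (i + 1) := by simp [hy]
    have y₂ : y (i + 1) = x i := by simp [hy]
    have y₃ : ∀ j, j ≠ i → j ≠ i + 1 → y j = x j := fun j h₁ h₂ => by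
      simp [hy, Equiv.swap_apply_of_ne_of_ne h₁ h₂]
    have hfire : HasCoords n (fire (MtypeC n) lam i) y := h.fire_of_lt hi hin y₁ y₂ y₃
    obtain ⟨hlegal, hcoords⟩ := ih (by omega) hfire (by rw [y₂]; exact hpos)
      (fun k hk hkn => by
        rw [y₂, y₃ k (by omega) (by omega)]
        exact hx k (by omega) hkn)
    rw [typeCBlock_of_lt hin]
    refine ⟨⟨hi, hin.le, ?_, ?_⟩, ?_⟩
    · rw [h.2 i hi hin.le]
      linarith
    · rw [legalSeq_append]
      refine ⟨hlegal, hi, hin.le, ?_, trivial⟩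
      rw [hcoords.2 i hi hin.le, Function.update_self, Function.update_of_ne (by omega), y₁, y₂]
      linarith
    · change HasCoords n (fireList _ (fire _ lam i) _) _
      rw [fireList_append]
      refine hcoords.fire_of_lt hi hin ?_ ?_ fun j h₁ h₂ => ?_
      · rw [Function.update_self, Function.update_self, y₂]
      · rw [Function.update_of_ne (by omega), Function.update_of_ne (by omega), y₁]
      · rw [Function.update_of_ne h₁, Function.update_of_ne h₂, y₃ j h₁ h₂]

/-- The blocks at `m, m-1, …, 1` negate the coordinates `1, …, m` of a position whose later
coordinates have been negated already. -/
theorem HasCoords.neg_of_blocks {n : ℕ} {x : ℕ → ℝ} (hpos : ∀ i, 1 ≤ i → i ≤ n → 0 < x i)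
    (hx : ∀ i k, 1 ≤ i → i < k → k ≤ n → x k < x i) (m : ℕ) (hm : m ≤ n) (lam : ℕ → ℝ)
    (h : HasCoords n lam fun j => if 1 ≤ j ∧ j ≤ m then x j else -x j) :
    LegalSeq n (MtypeC n) lam ((List.range' 1 m).reverse.flatMap (typeCBlock n)) ∧
      HasCoords n (fireList (MtypeC n) lam ((List.range' 1 m).reverse.flatMap (typeCBlock n)))
        fun j => -x j := by
  induction m generalizing lam with
  | zero =>
    refine ⟨trivial, ?_⟩
    change HasCoords n lam _
    convert h using 2 with j
    rw [if_neg (by omega)]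
  | succ m ih =>
    obtain ⟨hlegal, hcoords⟩ := h.neg_of_block hm (by omega)
      (by simpa using hpos (m + 1) (by omega) hm)
      (fun k hk hkn => by
        rw [if_neg (by omega), if_pos (by omega), abs_neg, abs_of_pos (hpos k (by omega) hkn)]
        exact hx _ _ (by omega) hk hkn)
    have hlist : (List.range' 1 (m + 1)).reverse.flatMap (typeCBlock n) =
        typeCBlock n (m + 1) ++ (List.range' 1 m).reverse.flatMap (typeCBlock n) := by
      simp [List.range'_concat, Nat.add_comm]
    rw [hlist, legalSeq_append, fireList_append, and_assoc]
    refine ⟨hlegal, ih (by omega) _ ?_⟩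
    convert hcoords using 2 with j
    by_cases e : j = m + 1
    · subst e
      simp
    · rw [Function.update_of_ne e]
      exact if_congr (by omega) rfl rfl

/-- On type `C n` (`n ≥ 3`), from a strongly dominant position `(a 1, …, a n)` the
firing sequence `(s_n, …, s_1)` is legal and yields `(-a 1, -a 2, …, -a n)`. -/
theorem typeC_from1 (n : ℕ) (hn : 3 ≤ n) (a : ℕ → ℝ)
    (ha : ∀ i, 1 ≤ i → i ≤ n → 0 < a i) :
    LegalSeq n (MtypeC n) a (seqBC1 n) ∧
    ∀ j, 1 ≤ j → j ≤ n → fireList (MtypeC n) a (seqBC1 n) j = -(a j) := by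
  set x : ℕ → ℝ := fun j => ∑ k ∈ Finset.Icc j n, a k with hx
  have hlast : x (n + 1) = 0 := by simp [hx]
  have hstep : ∀ j, j ≤ n → x j = a j + x (j + 1) := fun j hj => by
    simp only [hx]
    rw [← Finset.add_sum_Ioc_eq_sum_Icc hj, ← Finset.Icc_succ_left_eq_Ioc, Nat.succ_eq_succ]
  have hpos : ∀ i, 1 ≤ i → i ≤ n → 0 < x i := fun i hi hin =>
    Finset.sum_pos (fun k hk => by
      rw [Finset.mem_Icc] at hk
      exact ha k (by omega) hk.2) ⟨i, Finset.mem_Icc.2 ⟨le_rfl, hin⟩⟩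
  have hanti : ∀ i k, 1 ≤ i → i < k → k ≤ n → x k < x i := by
    intro i k hi hik
    induction k, hik using Nat.le_induction with
    | base =>
      intro hk
      have := hstep i (by omega)
      have := ha i hi (by omega)
      linarith
    | succ k hik ih =>
      intro hk
      have := hstep k (by omega)
      have := ha k (by omega) (by omega)
      linarith [ih (by omega)]
  obtain ⟨hlegal, hcoords⟩ := HasCoords.neg_of_blocks hpos hanti n le_rfl a
    ⟨by simp [hlast], fun j hj hjn => by
      have := hstep j hjn
      beta_reduce
      rw [if_pos ⟨hj, hjn⟩]
      split_ifs with h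
      · linarith
      · obtain rfl : j = n := by omega
        linarith⟩
  refine ⟨hlegal, fun j hj hjn => ?_⟩
  have := hcoords.2 j hj hjn
  have := hstep j hjn
  change fireList (MtypeC n) a ((List.range' 1 n).reverse.flatMap (typeCBlock n)) j = _
  linarith
end

section
/- On a connected Dynkin diagram of finite type, every game sequence played from any strongly dominant initial position is convergent of the following length (number of firings): n(n+1)/2 for type A_n, n² for type B_n, n² for type C_n, n(n−1) for type D_n, 36 for type E_6, 63 for type E_7, 120 for type E_8, 24 for type F_4, and 6 for type G_2. -/
/-- A convergent game sequence from `lam` on the graph with node set `{1,…,n}`: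
a legal firing sequence after which no node has a positive number. -/
def ConvSeq (n : ℕ) (M : ℕ → ℕ → ℤ) (lam : ℕ → ℝ) (s : List ℕ) : Prop :=
  LegalSeq n M lam s ∧ ∀ i, 1 ≤ i → i ≤ n → fireList M lam s i ≤ 0

/-- The sequence of positions along an infinite firing sequence `f`. -/
def posSeq (M : ℕ → ℕ → ℤ) (lam : ℕ → ℝ) (f : ℕ → ℕ) : ℕ → (ℕ → ℝ)
  | 0 => lam
  | k + 1 => fire M (posSeq M lam f k) (f k)

/-- A divergent game sequence from `lam` on the graph with node set `{1,…,n}`: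
an infinite sequence of legal firings of nodes of the graph. -/
def DivergentSeq (n : ℕ) (M : ℕ → ℕ → ℤ) (lam : ℕ → ℝ) (f : ℕ → ℕ) : Prop :=
  ∀ k, 1 ≤ f k ∧ f k ≤ n ∧ 0 < posSeq M lam f k (f k)

/-- A GCM graph with node set `{1,…,n}` is admissible if there is a nonzero dominant
position from which some game sequence converges. -/
def Admissible (n : ℕ) (M : ℕ → ℕ → ℤ) : Prop :=
  ∃ lam : ℕ → ℝ, (∀ i, 1 ≤ i → i ≤ n → 0 ≤ lam i) ∧
    (∃ i, 1 ≤ i ∧ i ≤ n ∧ lam i ≠ 0) ∧ ∃ s : List ℕ, ConvSeq n M lam s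

/-- The GCM of type `E n` (`n = 6, 7, 8`) on nodes `{1,…,n}`: edges `{1,3}`, `{3,4}`,
`{2,4}`, `{4,5}`, `{5,6}`, plus `{6,7}` if `n ≥ 7` and `{7,8}` if `n = 8`,
all amplitudes `-1`. -/
def MtypeE (n : ℕ) : ℕ → ℕ → ℤ := fun i j =>
  if i = j then 2
  else if (min i j, max i j) = (1, 3) ∨ (min i j, max i j) = (3, 4) ∨
          (min i j, max i j) = (2, 4) ∨ (min i j, max i j) = (4, 5) ∨
          (min i j, max i j) = (5, 6) ∨ ((min i j, max i j) = (6, 7) ∧ 7 ≤ n) ∨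
          ((min i j, max i j) = (7, 8) ∧ n = 8) then -1
  else 0

/-- The GCM of type `F 4` on nodes `{1,2,3,4}`. -/
def MtypeF : ℕ → ℕ → ℤ := fun i j =>
  if i = j then 2
  else if (i, j) = (2, 3) then -2
  else if (i, j) = (1, 2) ∨ (i, j) = (2, 1) ∨ (i, j) = (3, 2) ∨ (i, j) = (3, 4) ∨
          (i, j) = (4, 3) then -1
  else 0

/-- The GCM of type `G 2` on nodes `{1,2}`: `M 1 2 = -1`, `M 2 1 = -3`. -/
def MtypeG : ℕ → ℕ → ℤ := fun i j =>
  if i = j then 2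
  else if (i, j) = (1, 2) then -1
  else if (i, j) = (2, 1) then -3
  else 0

/-- A linear model of the numbers game with GCM `M` on the nodes `{1,…,n}`: positions are encoded by
points `x : X`, on which the positive roots take the real values `ev x`. The value at the simple
root `i` is the number on node `i`, and the reflection in that simple root permutes the other
positive roots. -/
structure RootModel (n : ℕ) (M : ℕ → ℕ → ℤ) (ι X : Type*) [DecidableEq ι] where
  roots : Finset ι
  simple : ℕ → ι
  ev : X → ι → ℝ
  act : ℕ → X → X
  refl : ℕ → ι → ι
  diag : ∀ i, 1 ≤ i → i ≤ n → M i i = 2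
  simple_mem : ∀ i, 1 ≤ i → i ≤ n → simple i ∈ roots
  ev_act_simple : ∀ i j x, 1 ≤ i → i ≤ n → 1 ≤ j → j ≤ n →
    ev (act i x) (simple j) = ev x (simple j) - M i j * ev x (simple i)
  refl_mem : ∀ i a, 1 ≤ i → i ≤ n → a ∈ roots.erase (simple i) →
    refl i a ∈ roots.erase (simple i)
  refl_refl : ∀ i a, 1 ≤ i → i ≤ n → a ∈ roots.erase (simple i) → refl i (refl i a) = a
  ev_act : ∀ i a x, 1 ≤ i → i ≤ n → a ∈ roots.erase (simple i) →
    ev (act i x) a = ev x (refl i a)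
  exists_rep : ∀ lam : ℕ → ℝ, ∃ x, ∀ i, 1 ≤ i → i ≤ n → ev x (simple i) = lam i
  ev_pos : ∀ x, (∀ i, 1 ≤ i → i ≤ n → 0 < ev x (simple i)) → ∀ a ∈ roots, 0 < ev x a
  ev_nonpos : ∀ x, (∀ i, 1 ≤ i → i ≤ n → ev x (simple i) ≤ 0) → ∀ a ∈ roots, ev x a ≤ 0

namespace RootModel

variable {n : ℕ} {M : ℕ → ℕ → ℤ} {ι X : Type*} [DecidableEq ι] (m : RootModel n M ι X)

/-- The number of positive roots taking a positive value at `x`. -/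
noncomputable def posCount (x : X) : ℕ := (m.roots.filter fun a => 0 < m.ev x a).card

/-- The point `x` encodes the position `lam`. -/
def Rep (x : X) (lam : ℕ → ℝ) : Prop := ∀ i, 1 ≤ i → i ≤ n → m.ev x (m.simple i) = lam i

variable {m}

theorem Rep.fire {x : X} {lam : ℕ → ℝ} (h : m.Rep x lam) {i : ℕ} (h1 : 1 ≤ i) (hn : i ≤ n) :
    m.Rep (m.act i x) (fire M lam i) := fun j hj hj' => by
  rw [m.ev_act_simple i j x h1 hn hj hj', h i h1 hn, h j hj hj', _root_.fire]

theorem posCount_act {x : X} {i : ℕ} (h1 : 1 ≤ i) (hn : i ≤ n) (hx : 0 < m.ev x (m.simple i)) :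
    m.posCount (m.act i x) + 1 = m.posCount x := by
  have hneg : ¬ 0 < m.ev (m.act i x) (m.simple i) := by
    rw [m.ev_act_simple i i x h1 hn h1 hn, m.diag i h1 hn]
    push_cast
    linarith
  unfold posCount
  rw [← Finset.insert_erase (m.simple_mem i h1 hn), Finset.filter_insert, Finset.filter_insert,
    if_neg hneg, if_pos hx, Finset.card_insert_of_notMem (by simp)]
  congr 1
  refine Finset.card_nbij' (m.refl i) (m.refl i) ?_ ?_ ?_ ?_
  · intro a ha
    rw [Finset.mem_coe, Finset.mem_filter] at ha ⊢
    exact ⟨m.refl_mem i a h1 hn ha.1, m.ev_act i a x h1 hn ha.1 ▸ ha.2⟩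
  · intro a ha
    rw [Finset.mem_coe, Finset.mem_filter] at ha ⊢
    refine ⟨m.refl_mem i a h1 hn ha.1, ?_⟩
    rw [m.ev_act i _ x h1 hn (m.refl_mem i a h1 hn ha.1), m.refl_refl i a h1 hn ha.1]
    exact ha.2
  · exact fun a ha => m.refl_refl i a h1 hn (Finset.mem_filter.1 ha).1
  · exact fun a ha => m.refl_refl i a h1 hn (Finset.mem_filter.1 ha).1

theorem Rep.length_eq {x : X} {lam : ℕ → ℝ} (h : m.Rep x lam) {s : List ℕ}
    (hs : ConvSeq n M lam s) : s.length = m.posCount x := by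
  induction s generalizing x lam with
  | nil =>
    have : ∀ a ∈ m.roots, m.ev x a ≤ 0 :=
      m.ev_nonpos x fun i h1 hn => (h i h1 hn).trans_le (hs.2 i h1 hn)
    exact (Finset.card_eq_zero.2 (Finset.filter_eq_empty_iff.2 fun a ha =>
      (this a ha).not_gt)).symm
  | cons i s ih =>
    obtain ⟨⟨h1, hn, hi, hl⟩, hend⟩ := hs
    rw [List.length_cons, ih (h.fire h1 hn) ⟨hl, hend⟩]
    exact posCount_act h1 hn ((h i h1 hn).symm ▸ hi)

theorem Rep.not_divergent {x : X} {lam : ℕ → ℝ} (h : m.Rep x lam) (f : ℕ → ℕ) :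
    ¬ DivergentSeq n M lam f := by
  intro hf
  have key : ∀ k, ∃ y, m.Rep y (posSeq M lam f k) ∧ m.posCount y + k = m.posCount x := by
    intro k
    induction k with
    | zero => exact ⟨x, h, rfl⟩
    | succ k ih =>
      obtain ⟨y, hy, hk⟩ := ih
      obtain ⟨h1, hn, hp⟩ := hf k
      refine ⟨m.act (f k) y, hy.fire h1 hn, ?_⟩
      have := posCount_act (m := m) h1 hn ((hy _ h1 hn).symm ▸ hp)
      omega
  obtain ⟨y, -, hy⟩ := key (m.posCount x + 1)
  omega

variable (m)

/-- Every game from a strongly dominant position takes as many firings as there are positive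
roots. -/
theorem game_length {lam : ℕ → ℝ} (hdom : ∀ i, 1 ≤ i → i ≤ n → 0 < lam i) :
    (¬ ∃ f : ℕ → ℕ, DivergentSeq n M lam f) ∧
    ∀ s : List ℕ, ConvSeq n M lam s → s.length = m.roots.card := by
  obtain ⟨x, hx⟩ := m.exists_rep lam
  refine ⟨fun ⟨f, hf⟩ => Rep.not_divergent (m := m) hx f hf, fun s hs => ?_⟩
  rw [Rep.length_eq (m := m) hx hs, posCount, Finset.filter_true_of_mem]
  exact m.ev_pos x fun i h1 hn => (hx i h1 hn).symm ▸ hdom i h1 hn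

end RootModel

/-- The `k`-th coordinate, for `k ≥ 1`, of the vector with code `c`: its coordinates are the decimal
digits of `c`, starting from the units. -/
def coeff (c k : ℕ) : ℕ := c / 10 ^ (k - 1) % 10

/-- The value at `lam` of the vector with code `c`. -/
noncomputable def evalCode (n : ℕ) (lam : ℕ → ℝ) (c : ℕ) : ℝ :=
  ∑ k ∈ Finset.Icc 1 n, coeff c k * lam k

/-- The pairing of row `i` of `M` with the vector with code `c`. -/
def pairCode (n : ℕ) (M : ℕ → ℕ → ℤ) (i c : ℕ) : ℤ :=
  ((List.range' 1 n).map fun k => M i k * coeff c k).sum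

/-- The code of the reflection of a vector in the `i`-th simple root, provided that its coordinates
are decimal digits. -/
def reflectCode (n : ℕ) (M : ℕ → ℕ → ℤ) (i c : ℕ) : ℕ :=
  (c - pairCode n M i c * 10 ^ (i - 1) : ℤ).toNat

/-- The decidable conditions making `R` a list of codes of the positive roots of `M`. Membership of
reflections is phrased with `Nat.beq` for the sake of kernel reduction. -/
abbrev IsRootList (n : ℕ) (M : ℕ → ℕ → ℤ) (R : List ℕ) : Prop :=
  (∀ c ∈ R, ∃ k ∈ List.range' 1 n, 0 < coeff c k) ∧
  ∀ i ∈ List.range' 1 n, M i i = 2 ∧ 10 ^ (i - 1) ∈ R ∧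
    (∀ k ∈ List.range' 1 n, coeff (10 ^ (i - 1)) k = if k = i then 1 else 0) ∧
    ∀ c ∈ R, c = 10 ^ (i - 1) ∨
      (pairCode n M i c ≤ coeff c i ∧ coeff c i < pairCode n M i c + 10 ∧
        R.any (Nat.beq (reflectCode n M i c)) = true)

theorem mem_range'_one {n i : ℕ} : i ∈ List.range' 1 n ↔ i ∈ Finset.Icc 1 n := by
  rw [List.mem_range'_1, Finset.mem_Icc]; omega

theorem pairCode_eq_sum (n : ℕ) (M : ℕ → ℕ → ℤ) (i c : ℕ) :
    pairCode n M i c = ∑ k ∈ Finset.Icc 1 n, M i k * coeff c k := by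
  rw [pairCode, ← List.sum_toFinset _ List.nodup_range']
  exact Finset.sum_congr (by ext k; rw [List.mem_toFinset, mem_range'_one]) fun _ _ => rfl

theorem evalCode_fire (n : ℕ) (M : ℕ → ℕ → ℤ) (lam : ℕ → ℝ) (i c : ℕ) :
    evalCode n (fire M lam i) c = evalCode n lam c - pairCode n M i c * lam i := by
  rw [pairCode_eq_sum]
  push_cast
  simp only [evalCode, fire, Finset.sum_mul, ← Finset.sum_sub_distrib]
  exact Finset.sum_congr rfl fun k _ => by ring

theorem IsRootList.evalCode_simple {n : ℕ} {M : ℕ → ℕ → ℤ} {R : List ℕ} (hR : IsRootList n M R)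
    (lam : ℕ → ℝ) {i : ℕ} (h1 : 1 ≤ i) (hn : i ≤ n) : evalCode n lam (10 ^ (i - 1)) = lam i := by
  have hi := Finset.mem_Icc.2 ⟨h1, hn⟩
  have h := (hR.2 i (mem_range'_one.2 hi)).2.2.1
  rw [evalCode, Finset.sum_congr rfl fun k hk => by rw [h k (mem_range'_one.2 hk)]]
  simp [h1, hn]

theorem coeff_sub_mul {c d i k : ℕ} {p : ℤ} (hk : 1 ≤ k) (hd : (d : ℤ) = c - p * 10 ^ (i - 1))
    (hp : p ≤ coeff c i) (hp' : coeff c i < p + 10) (hi : 1 ≤ i) :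
    (coeff d k : ℤ) = coeff c k - p * if k = i then 1 else 0 := by
  have hB : (10 : ℤ) ^ (i - 1) ≠ 0 := by positivity
  have hdiv : (d : ℤ) / 10 ^ (i - 1) = c / 10 ^ (i - 1) - p := by
    rw [hd, Int.sub_mul_ediv_right _ _ hB]
  simp only [coeff] at hp hp' ⊢
  push_cast at hp hp' ⊢
  rcases lt_trichotomy k i with h | rfl | h
  · obtain ⟨j, rfl⟩ : ∃ j, i = k + 1 + j := ⟨i - (k + 1), by omega⟩
    obtain ⟨k, rfl⟩ : ∃ l, k = l + 1 := ⟨k - 1, by omega⟩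
    rw [if_neg h.ne, mul_zero, sub_zero, hd,
      show p * 10 ^ (k + 1 + 1 + j - 1) = p * 10 ^ j * 10 * 10 ^ (k + 1 - 1) by
        rw [show k + 1 + 1 + j - 1 = j + 1 + k by omega, Nat.add_sub_cancel]; ring,
      Int.sub_mul_ediv_right _ _ (by positivity), Int.sub_mul_emod_self_right]
  · rw [if_pos rfl, hdiv]
    omega
  · obtain ⟨j, rfl⟩ : ∃ j, k = i + j + 1 := ⟨k - (i + 1), by omega⟩
    rw [if_neg h.ne', mul_zero, sub_zero,
      show (10 : ℤ) ^ (i + j + 1 - 1) = 10 ^ (i - 1) * 10 * 10 ^ j by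
        rw [show i + j + 1 - 1 = i - 1 + 1 + j by omega]; ring,
      ← Int.ediv_ediv_of_nonneg (by positivity), ← Int.ediv_ediv_of_nonneg (by positivity),
      ← Int.ediv_ediv_of_nonneg (by positivity), ← Int.ediv_ediv_of_nonneg (by positivity), hdiv]
    congr 2
    omega

theorem IsRootList.reflectCode_spec {n : ℕ} {M : ℕ → ℕ → ℤ} {R : List ℕ} (hR : IsRootList n M R)
    {i c : ℕ} (hi : i ∈ List.range' 1 n) (hc : c ∈ R) (hne : c ≠ 10 ^ (i - 1)) :
    reflectCode n M i c ∈ R ∧ reflectCode n M i c ≠ 10 ^ (i - 1) ∧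
    reflectCode n M i (reflectCode n M i c) = c ∧
    ∀ k ∈ Finset.Icc 1 n, (coeff (reflectCode n M i c) k : ℤ) =
      coeff c k - pairCode n M i c * if k = i then 1 else 0 := by
  obtain ⟨hMi, hsimple, hcoeff, h⟩ := hR.2 i hi
  obtain ⟨h1, h2, h3⟩ := (h c hc).resolve_left hne
  have hi' := mem_range'_one.1 hi
  have hmem : ∀ d, R.any (Nat.beq d) = true → d ∈ R := by
    intro d hd
    obtain ⟨e, he, hde⟩ := List.any_eq_true.1 hd
    exact Nat.eq_of_beq_eq_true hde ▸ he
  have hpos : ∀ d ∈ R, d ≠ 0 := by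
    rintro d hd rfl
    obtain ⟨k, -, hk⟩ := hR.1 0 hd
    simp [coeff] at hk
  have hcast : ∀ d, reflectCode n M i d ∈ R →
      (reflectCode n M i d : ℤ) = d - pairCode n M i d * 10 ^ (i - 1) := fun d hd => by
    have := hpos _ hd
    unfold reflectCode at this ⊢
    omega
  have hk : ∀ k ∈ Finset.Icc 1 n, (coeff (reflectCode n M i c) k : ℤ) =
      coeff c k - pairCode n M i c * if k = i then 1 else 0 := fun k hk =>
    coeff_sub_mul (Finset.mem_Icc.1 hk).1 (hcast c (hmem _ h3)) h1 h2 (Finset.mem_Icc.1 hi').1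
  have hpair : pairCode n M i (reflectCode n M i c) = -pairCode n M i c := by
    rw [pairCode_eq_sum, Finset.sum_congr rfl fun k hk' => by rw [hk k hk', mul_sub],
      Finset.sum_sub_distrib, ← pairCode_eq_sum]
    simp only [mul_ite, mul_one, mul_zero, Finset.sum_ite_eq', hi', if_true, hMi]
    ring
  have hinv : reflectCode n M i (reflectCode n M i c) = c := by
    rw [reflectCode, hpair, hcast c (hmem _ h3)]
    simp
  refine ⟨hmem _ h3, fun heq => hpos c hc ?_, hinv, hk⟩
  have hpair' : pairCode n M i (10 ^ (i - 1)) = 2 := by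
    rw [pairCode_eq_sum, Finset.sum_congr rfl fun k hk' => by
      rw [hcoeff k (mem_range'_one.2 hk')]]
    rw [Finset.mem_Icc] at hi'
    simp [hi', hMi]
  rw [← hinv, heq, reflectCode, hpair']
  push_cast
  have : (0 : ℤ) < 10 ^ (i - 1) := by positivity
  omega

/-- The root model given by an explicit list of codes of positive roots. -/
noncomputable def RootModel.ofList {n : ℕ} {M : ℕ → ℕ → ℤ} {R : List ℕ} (hR : IsRootList n M R) :
    RootModel n M ℕ (ℕ → ℝ) :=
  have node : ∀ i, 1 ≤ i → i ≤ n → i ∈ List.range' 1 n := fun i h1 hn =>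
    mem_range'_one.2 (Finset.mem_Icc.2 ⟨h1, hn⟩)
  { roots := R.toFinset
    simple := fun i => 10 ^ (i - 1)
    ev := evalCode n
    act := fun i lam => fire M lam i
    refl := reflectCode n M
    diag := fun i h1 hn => (hR.2 i (node i h1 hn)).1
    simple_mem := fun i h1 hn => List.mem_toFinset.2 (hR.2 i (node i h1 hn)).2.1
    ev_act_simple := fun i j x h1 hn hj hj' => by
      rw [hR.evalCode_simple _ hj hj', hR.evalCode_simple _ hj hj', hR.evalCode_simple _ h1 hn,
        fire]
    refl_mem := fun i c h1 hn hc => by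
      rw [Finset.mem_erase, List.mem_toFinset] at hc ⊢
      obtain ⟨h, h', -⟩ := hR.reflectCode_spec (node i h1 hn) hc.2 hc.1
      exact ⟨h', h⟩
    refl_refl := fun i c h1 hn hc => by
      rw [Finset.mem_erase, List.mem_toFinset] at hc
      exact (hR.reflectCode_spec (node i h1 hn) hc.2 hc.1).2.2.1
    ev_act := fun i c x h1 hn hc => by
      rw [Finset.mem_erase, List.mem_toFinset] at hc
      have h := (hR.reflectCode_spec (node i h1 hn) hc.2 hc.1).2.2.2
      have hterm : ∀ k ∈ Finset.Icc 1 n, (coeff (reflectCode n M i c) k : ℝ) * x k =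
          coeff c k * x k - pairCode n M i c * if k = i then x k else 0 := fun k hk => by
        have hk' := congrArg (Int.cast (R := ℝ)) (h k hk)
        push_cast at hk'
        rw [hk']
        split_ifs <;> ring
      rw [evalCode_fire, evalCode, evalCode, Finset.sum_congr rfl hterm, Finset.sum_sub_distrib,
        ← Finset.mul_sum, Finset.sum_ite_eq', if_pos (Finset.mem_Icc.2 ⟨h1, hn⟩)]
    exists_rep := fun lam => ⟨lam, fun i h1 hn => hR.evalCode_simple lam h1 hn⟩
    ev_pos := fun x hx c hc => by
      have hx' : ∀ k ∈ Finset.Icc 1 n, 0 < x k := fun k hk => by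
        rw [Finset.mem_Icc] at hk
        exact hR.evalCode_simple x hk.1 hk.2 ▸ hx k hk.1 hk.2
      obtain ⟨k, hk, hck⟩ := hR.1 c (List.mem_toFinset.1 hc)
      rw [mem_range'_one] at hk
      exact Finset.sum_pos' (fun k hk => mul_nonneg (Nat.cast_nonneg _) (hx' k hk).le)
        ⟨k, hk, mul_pos (Nat.cast_pos.2 hck) (hx' k hk)⟩
    ev_nonpos := fun x hx c _ => Finset.sum_nonpos fun k hk => by
      rw [Finset.mem_Icc] at hk
      exact mul_nonpos_of_nonneg_of_nonpos (Nat.cast_nonneg _)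
        (hR.evalCode_simple x hk.1 hk.2 ▸ hx k hk.1 hk.2) }

theorem IsRootList.game_length {n : ℕ} {M : ℕ → ℕ → ℤ} {R : List ℕ}
    (hR : IsRootList n M R) (hnd : R.Nodup) {lam : ℕ → ℝ}
    (hdom : ∀ i, 1 ≤ i → i ≤ n → 0 < lam i) :
    (¬ ∃ f : ℕ → ℕ, DivergentSeq n M lam f) ∧
    ∀ s : List ℕ, ConvSeq n M lam s → s.length = R.length := by
  rw [← List.toFinset_card_of_nodup hnd]
  exact (RootModel.ofList hR).game_length hdom

/-- The codes of the positive roots of type `E 8`. -/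
def rootsE8 : List ℕ :=
  [1, 10, 100, 1000, 10000, 100000, 1000000, 10000000, 101, 1010, 1100, 11000, 110000, 1100000,
   11000000, 1101, 1110, 11010, 11100, 111000, 1110000, 11100000, 1111, 11101, 11110, 111010,
   111100, 1111000, 11110000, 11111, 12110, 111101, 111110, 1111010, 1111100, 11111000, 12111,
   111111, 112110, 1111101, 1111110, 11111010, 11111100, 12211, 112111, 122110, 1111111, 1112110,
   11111101, 11111110, 112211, 122111, 1112111, 1122110, 11111111, 11112110, 122211, 1112211,
   1122111, 1222110, 11112111, 11122110, 123211, 1122211, 1222111, 11112211, 11122111, 11222110,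
   123221, 1123211, 1222211, 11122211, 11222111, 12222110, 1123221, 1223211, 11123211, 11222211,
   12222111, 1223221, 1233211, 11123221, 11223211, 12222211, 1233221, 11223221, 11233211,
   12223211, 1234221, 11233221, 12223221, 12233211, 1234321, 11234221, 12233221, 12333211,
   1234322, 11234321, 12234221, 12333221, 11234322, 12234321, 12334221, 12234322, 12334321,
   12344221, 12334322, 12344321, 12344322, 12345321, 12345322, 12345331, 12345332, 12345422,
   12345432, 12346432, 12356432, 12456432, 13456432, 23456432]

/-- The codes of the positive roots of type `F 4`. -/
def rootsF4 : List ℕ :=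
  [1, 10, 100, 1000, 11, 110, 1100, 111, 120, 1110, 121, 1111, 1120, 122, 1121, 1220, 1122, 1221,
   1222, 1231, 1232, 1242, 1342, 2342]

/-- The codes of the positive roots of type `G 2`. -/
def rootsG2 : List ℕ :=
  [1, 10, 11, 21, 31, 32]

theorem nodup_rootsE8 : rootsE8.Nodup := by decide +kernel

theorem isRootList_E8 : IsRootList 8 (MtypeE 8) rootsE8 := by decide +kernel

theorem isRootList_E7 : IsRootList 7 (MtypeE 7) (rootsE8.filter (· < 10 ^ 7)) := by
  decide +kernel

theorem isRootList_E6 : IsRootList 6 (MtypeE 6) (rootsE8.filter (· < 10 ^ 6)) := by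
  decide +kernel

theorem isRootList_F4 : IsRootList 4 MtypeF rootsF4 := by decide +kernel

theorem isRootList_G2 : IsRootList 2 MtypeG rootsG2 := by decide +kernel

/-- The transposition of `i` and `i + 1`. -/
def adjSwap (i k : ℕ) : ℕ := if k = i then i + 1 else if k = i + 1 then i else k

theorem adjSwap_adjSwap (i k : ℕ) : adjSwap i (adjSwap i k) = k := by grind [adjSwap]

theorem lt_of_sub_succ_pos {x : ℕ → ℝ} {n : ℕ}
    (hx : ∀ i, 1 ≤ i → i < n → 0 < x i - x (i + 1)) {a b : ℕ} (ha : 1 ≤ a) (hab : a < b)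
    (hb : b ≤ n) : x b < x a := by
  induction b, hab using Nat.le_induction with
  | base => linarith [hx a ha (by omega)]
  | succ b hab ih =>
    have hab' : a + 1 ≤ b := hab
    linarith [hx b (by omega) (by omega), ih (by omega)]

theorem le_of_sub_succ_nonpos {x : ℕ → ℝ} {n : ℕ}
    (hx : ∀ i, 1 ≤ i → i < n → x i - x (i + 1) ≤ 0) {a b : ℕ} (ha : 1 ≤ a) (hab : a ≤ b)
    (hb : b ≤ n) : x a ≤ x b := by
  induction b, hab using Nat.le_induction with
  | base => exact le_rfl
  | succ b hab ih => linarith [hx b (by omega) (by omega), ih (by omega)]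

theorem exists_sub_succ_eq (lam : ℕ → ℝ) (n : ℕ) (t : ℝ) :
    ∃ x : ℕ → ℝ, x n = t ∧ ∀ i, i < n → x i - x (i + 1) = lam i := by
  refine ⟨fun k => ∑ j ∈ Finset.Ico k n, lam j + t, by simp, fun i hi => ?_⟩
  dsimp only
  rw [Finset.sum_eq_sum_Ico_succ_bot hi]
  ring

/-- The root model of type `A n`: the pair `(a, b)` with `a < b` stands for `e_a - e_b`. -/
def RootModel.typeA (n : ℕ) : RootModel n (MtypeA n) (ℕ × ℕ) (ℕ → ℝ) where
  roots := (Finset.Icc 1 (n + 1) ×ˢ Finset.Icc 1 (n + 1)).filter fun p => p.1 < p.2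
  simple i := (i, i + 1)
  ev x p := x p.1 - x p.2
  act i x k := x (adjSwap i k)
  refl i p := (adjSwap i p.1, adjSwap i p.2)
  diag i _ _ := by simp [MtypeA]
  simple_mem i h1 hn := by simp; omega
  ev_act_simple i j x h1 hn hj hj' := by
    rcases lt_trichotomy i j with h | rfl | h
    · by_cases hs : i + 1 = j
      · subst hs; simp [MtypeA, adjSwap]; grind
      · simp [MtypeA, adjSwap]; grind
    · simp [MtypeA, adjSwap]; ring
    · by_cases hs : j + 1 = i
      · subst hs; simp [MtypeA, adjSwap]; grind
      · simp [MtypeA, adjSwap]; grind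
  refl_mem i p h1 hn hp := by
    obtain ⟨a, b⟩ := p
    simp only [Finset.mem_erase, Finset.mem_filter, Finset.mem_product, Finset.mem_Icc, ne_eq,
      Prod.mk.injEq] at hp ⊢
    grind [adjSwap]
  refl_refl i p h1 hn hp := by simp [adjSwap_adjSwap]
  ev_act i p x h1 hn hp := rfl
  exists_rep lam := by
    obtain ⟨x, -, hx⟩ := exists_sub_succ_eq lam (n + 1) 0
    exact ⟨x, fun i _ hn => hx i (by omega)⟩
  ev_pos x hx p hp := by
    simp only [Finset.mem_filter, Finset.mem_product, Finset.mem_Icc] at hp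
    exact sub_pos.2 (lt_of_sub_succ_pos (n := n + 1) (fun i h1 hn => hx i h1 (by omega))
      hp.1.1.1 hp.2 hp.1.2.2)
  ev_nonpos x hx p hp := by
    simp only [Finset.mem_filter, Finset.mem_product, Finset.mem_Icc] at hp
    exact sub_nonpos.2 (le_of_sub_succ_nonpos (n := n + 1) (fun i h1 hn => hx i h1 (by omega))
      hp.1.1.1 hp.2.le hp.1.2.2)

theorem RootModel.card_typeA (n : ℕ) : (RootModel.typeA n).roots.card = n * (n + 1) / 2 := by
  have h : ∀ b ∈ Finset.Icc 1 (n + 1),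
      (∑ a ∈ Finset.Icc 1 (n + 1), if a < b then 1 else 0) = b - 1 := by
    intro b hb
    rw [Finset.mem_Icc] at hb
    rw [← Finset.card_filter, show (Finset.Icc 1 (n + 1)).filter (· < b) = Finset.Ico 1 b by
      ext a; simp; omega, Nat.card_Ico]
  change (Finset.filter _ _).card = _
  rw [Finset.card_filter, Finset.sum_product_right, Finset.sum_congr rfl h,
    ← Finset.Ico_add_one_right_eq_Icc, Finset.sum_Ico_eq_sum_range]
  simp only [Nat.add_sub_cancel, Nat.add_sub_cancel_left, Finset.sum_range_id]
  rw [mul_comm]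

/-- The value of the positive root `(a, b)` of type `B`, `C` or `D`, which is `e_a - e_b` if
`a < b`, `e_a + e_b` if `b < a` and `t e_a` if `a = b`. -/
noncomputable def signedEv (t : ℝ) (x : ℕ → ℝ) (p : ℕ × ℕ) : ℝ :=
  if p.1 < p.2 then x p.1 - x p.2 else if p.2 < p.1 then x p.1 + x p.2 else t * x p.1

/-- The action of the first `n - 1` reflections on the positive roots of type `B`, `C` or `D`. -/
def swapRefl (i : ℕ) (p : ℕ × ℕ) : ℕ × ℕ :=
  if p = (i + 1, i) then p else (adjSwap i p.1, adjSwap i p.2)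

theorem swapRefl_swapRefl {i : ℕ} {p : ℕ × ℕ} (hp : p ≠ (i, i + 1)) :
    swapRefl i (swapRefl i p) = p := by
  obtain ⟨a, b⟩ := p
  grind [swapRefl, adjSwap]

theorem swapRefl_mem {n i : ℕ} (h1 : 1 ≤ i) (hi : i < n) {p : ℕ × ℕ} (hp : p ≠ (i, i + 1))
    (hmem : p ∈ Finset.Icc 1 n ×ˢ Finset.Icc 1 n) :
    swapRefl i p ≠ (i, i + 1) ∧ swapRefl i p ∈ Finset.Icc 1 n ×ˢ Finset.Icc 1 n := by
  obtain ⟨a, b⟩ := p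
  simp only [Finset.mem_product, Finset.mem_Icc] at hmem ⊢
  simp only [swapRefl, adjSwap]
  grind

theorem swapRefl_fst_ne_snd {i : ℕ} {p : ℕ × ℕ} (hp : p.1 ≠ p.2) :
    (swapRefl i p).1 ≠ (swapRefl i p).2 := by
  obtain ⟨a, b⟩ := p
  grind [swapRefl, adjSwap]

theorem signedEv_adjSwap (t : ℝ) (x : ℕ → ℝ) {i : ℕ} {p : ℕ × ℕ} (hp : p ≠ (i, i + 1)) :
    signedEv t (fun k => x (adjSwap i k)) p = signedEv t x (swapRefl i p) := by
  obtain ⟨a, b⟩ := p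
  grind [swapRefl, adjSwap, signedEv]

/-- The root model of the GCM `M` that agrees with type `A n` except at the edge between the last
two nodes, where the amplitudes are `-t` and `-2 / t`. -/
noncomputable def RootModel.typeBC (n : ℕ) (M : ℕ → ℕ → ℤ) (t : ℝ) (ht : 0 < t) (hn : 1 ≤ n)
    (hM : ∀ i j, 1 ≤ i → i ≤ n → 1 ≤ j → j ≤ n → ((i < n ∧ j < n) ∨ i = j) →
      M i j = MtypeA n i j)
    (hr : ∀ i, 1 ≤ i → i < n → (M i n : ℝ) = if i + 1 = n then -t else 0)
    (hl : ∀ i, 1 ≤ i → i < n → (M n i : ℝ) * t = if i + 1 = n then -2 else 0) :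
    RootModel n M (ℕ × ℕ) (ℕ → ℝ) where
  roots := Finset.Icc 1 n ×ˢ Finset.Icc 1 n
  simple i := if i = n then (n, n) else (i, i + 1)
  ev := signedEv t
  act i x k := if i = n then (if k = n then -x k else x k) else x (adjSwap i k)
  refl i p := if i = n then (if p.1 = n ∨ p.2 = n then (p.2, p.1) else p) else swapRefl i p
  diag i h1 hi := by rw [hM i i h1 hi h1 hi (.inr rfl)]; simp [MtypeA]
  simple_mem i h1 hi := by split_ifs <;> simp <;> omega
  ev_act_simple i j x h1 hi hj hj' := by
    by_cases hin : i = n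
    · subst hin
      by_cases hjn : j = i
      · subst hjn
        rw [hM j j h1 hi h1 hi (.inr rfl)]
        simp [signedEv, MtypeA]
        ring
      · have h := hl j hj (by omega)
        simp only [signedEv, hjn, if_true, if_false, lt_irrefl]
        rw [← mul_assoc, h]
        grind
    · by_cases hjn : j = n
      · subst hjn
        rw [hr i h1 (by omega)]
        simp only [signedEv, hin, if_true, if_false, lt_irrefl, adjSwap]
        grind
      · rw [hM i j h1 hi hj hj' (.inl ⟨by omega, by omega⟩)]
        simp only [hin, hjn, if_false]
        have := (RootModel.typeA n).ev_act_simple i j x h1 hi hj hj'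
        simpa [signedEv, RootModel.typeA] using this
  refl_mem i p h1 hi hp := by
    by_cases hin : i = n
    · obtain ⟨a, b⟩ := p
      simp only [Finset.mem_erase, Finset.mem_product, Finset.mem_Icc] at hp ⊢
      clear hM hr hl
      grind
    · simp only [hin, if_false, Finset.mem_erase] at hp ⊢
      exact swapRefl_mem h1 (by omega) hp.1 hp.2
  refl_refl i p h1 hi hp := by
    obtain ⟨a, b⟩ := p
    by_cases hin : i = n
    · grind
    · simp only [hin, if_false, Finset.mem_erase] at hp ⊢
      exact swapRefl_swapRefl hp.1
  ev_act i p x h1 hi hp := by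
    by_cases hin : i = n
    · obtain ⟨a, b⟩ := p
      simp only [Finset.mem_erase, Finset.mem_product, Finset.mem_Icc] at hp
      grind [signedEv]
    · simp only [hin, if_false, Finset.mem_erase] at hp ⊢
      exact signedEv_adjSwap t x hp.1
  exists_rep lam := by
    obtain ⟨x, hx, hx'⟩ := exists_sub_succ_eq lam n (lam n / t)
    refine ⟨x, fun i h1 hi => ?_⟩
    by_cases hin : i = n
    · subst hin
      simp only [signedEv, if_true, lt_irrefl, if_false, hx]
      field_simp
    · simp only [signedEv, hin, if_false, Nat.lt_succ_self, if_true]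
      exact hx' i (by omega)
  ev_pos x hx p hp := by
    obtain ⟨a, b⟩ := p
    simp only [Finset.mem_product, Finset.mem_Icc] at hp
    have hn0 : 0 < x n := by simpa [signedEv, ht] using hx n hn le_rfl
    have hs : ∀ i, 1 ≤ i → i < n → 0 < x i - x (i + 1) := fun i h1 hi => by
      simpa [signedEv, hi.ne] using hx i h1 hi.le
    have hpos : ∀ k, 1 ≤ k → k ≤ n → 0 < x k := fun k h1 hk => by
      rcases hk.eq_or_lt with rfl | hk
      · exact hn0
      · exact hn0.trans (lt_of_sub_succ_pos hs h1 hk le_rfl)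
    simp only [signedEv]
    split_ifs with h h'
    · exact sub_pos.2 (lt_of_sub_succ_pos hs hp.1.1 h hp.2.2)
    · exact add_pos (hpos a hp.1.1 hp.1.2) (hpos b hp.2.1 hp.2.2)
    · exact mul_pos ht (hpos a hp.1.1 hp.1.2)
  ev_nonpos x hx p hp := by
    obtain ⟨a, b⟩ := p
    simp only [Finset.mem_product, Finset.mem_Icc] at hp
    have hn0 : x n ≤ 0 := by
      have := hx n hn le_rfl
      simp only [signedEv, if_true, lt_irrefl, if_false] at this
      exact nonpos_of_mul_nonpos_right this ht
    have hs : ∀ i, 1 ≤ i → i < n → x i - x (i + 1) ≤ 0 := fun i h1 hi => by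
      simpa [signedEv, hi.ne] using hx i h1 hi.le
    have hneg : ∀ k, 1 ≤ k → k ≤ n → x k ≤ 0 := fun k h1 hk =>
      (le_of_sub_succ_nonpos hs h1 hk le_rfl).trans hn0
    simp only [signedEv]
    split_ifs with h h'
    · exact sub_nonpos.2 (le_of_sub_succ_nonpos hs hp.1.1 h.le hp.2.2)
    · exact add_nonpos (hneg a hp.1.1 hp.1.2) (hneg b hp.2.1 hp.2.2)
    · exact mul_nonpos_of_nonneg_of_nonpos ht.le (hneg a hp.1.1 hp.1.2)

/-- The root model of type `B n`. -/
noncomputable def RootModel.typeB (n : ℕ) (hn : 1 ≤ n) :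
    RootModel n (MtypeB n) (ℕ × ℕ) (ℕ → ℝ) :=
  .typeBC n (MtypeB n) 2 two_pos hn (by intros; grind [MtypeB, MtypeA])
    (by intro i h1 hi; simp [MtypeB]; grind) (by intro i h1 hi; simp [MtypeB]; grind)

/-- The root model of type `C n`. -/
noncomputable def RootModel.typeC (n : ℕ) (hn : 1 ≤ n) :
    RootModel n (MtypeC n) (ℕ × ℕ) (ℕ → ℝ) :=
  .typeBC n (MtypeC n) 1 one_pos hn (by intros; grind [MtypeC, MtypeA])
    (by intro i h1 hi; simp [MtypeC]; grind) (by intro i h1 hi; simp [MtypeC]; grind)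

/-- The action of the last reflection of type `D (k + 1)`, which sends `e_k` to `-e_{k+1}` and
`e_{k+1}` to `-e_k`, on the positive roots. -/
def forkRefl (k : ℕ) (p : ℕ × ℕ) : ℕ × ℕ :=
  if p = (k, k + 1) then p
  else if k ≤ p.1 ∨ k ≤ p.2 then (adjSwap k p.2, adjSwap k p.1) else p

theorem forkRefl_forkRefl {k : ℕ} {p : ℕ × ℕ} (hp : p ≠ (k + 1, k)) :
    forkRefl k (forkRefl k p) = p := by
  obtain ⟨a, b⟩ := p
  simp only [ne_eq, Prod.mk.injEq, forkRefl, adjSwap] at hp ⊢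
  grind

theorem forkRefl_mem {k : ℕ} (hk : 1 ≤ k) {p : ℕ × ℕ} (hp : p ≠ (k + 1, k))
    (hmem : p ∈ (Finset.Icc 1 (k + 1)).offDiag) :
    forkRefl k p ≠ (k + 1, k) ∧ forkRefl k p ∈ (Finset.Icc 1 (k + 1)).offDiag := by
  obtain ⟨a, b⟩ := p
  simp only [ne_eq, Prod.mk.injEq, Finset.mem_offDiag, Finset.mem_Icc, forkRefl, adjSwap]
    at hp hmem ⊢
  grind

/-- The root model of type `D n`. -/
noncomputable def RootModel.typeD (n : ℕ) (hn : 3 ≤ n) :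
    RootModel n (MtypeD n) (ℕ × ℕ) (ℕ → ℝ) where
  roots := (Finset.Icc 1 n).offDiag
  simple i := if i = n then (n, n - 1) else (i, i + 1)
  ev := signedEv 0
  act i x k := if i = n then
      (if k = n then -x (n - 1) else if k = n - 1 then -x n else x k)
    else x (adjSwap i k)
  refl i p := if i = n then forkRefl (n - 1) p else swapRefl i p
  diag i h1 hi := by simp [MtypeD]
  simple_mem i h1 hi := by split_ifs <;> simp <;> omega
  ev_act_simple i j x h1 hi hj hj' := by
    obtain ⟨n, rfl⟩ : ∃ k, n = k + 3 := ⟨n - 3, by omega⟩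
    by_cases hin : i = n + 3
    · subst hin
      by_cases hjn : j = n + 3
      · subst hjn
        simp [signedEv, MtypeD]
        ring
      · simp [signedEv, MtypeD, hjn, Ne.symm hjn]
        grind
    · by_cases hjn : j = n + 3
      · subst hjn
        simp [signedEv, MtypeD, hin, adjSwap]
        grind
      · have := (RootModel.typeA (n + 3)).ev_act_simple i j x h1 hi hj hj'
        rw [show MtypeD (n + 3) i j = MtypeA (n + 3) i j by grind [MtypeD, MtypeA]]
        simpa [signedEv, RootModel.typeA, hin, hjn] using this
  refl_mem i p h1 hi hp := by
    obtain ⟨n, rfl⟩ : ∃ k, n = k + 1 := ⟨n - 1, by omega⟩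
    rw [Finset.mem_erase] at hp ⊢
    by_cases hin : i = n + 1
    · simp only [hin, if_true, Nat.add_sub_cancel] at hp ⊢
      exact forkRefl_mem (by omega) hp.1 hp.2
    · simp only [hin, if_false] at hp ⊢
      obtain ⟨hp, hmem⟩ := hp
      obtain ⟨ha, hb, hab⟩ := Finset.mem_offDiag.1 hmem
      obtain ⟨h, hm⟩ := swapRefl_mem h1 (by omega) hp (Finset.mem_product.2 ⟨ha, hb⟩)
      rw [Finset.mem_product] at hm
      exact ⟨h, Finset.mem_offDiag.2 ⟨hm.1, hm.2, swapRefl_fst_ne_snd hab⟩⟩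
  refl_refl i p h1 hi hp := by
    obtain ⟨n, rfl⟩ : ∃ k, n = k + 1 := ⟨n - 1, by omega⟩
    rw [Finset.mem_erase] at hp
    by_cases hin : i = n + 1
    · simp only [hin, if_true, Nat.add_sub_cancel] at hp ⊢
      exact forkRefl_forkRefl hp.1
    · simp only [hin, if_false] at hp ⊢
      exact swapRefl_swapRefl hp.1
  ev_act i p x h1 hi hp := by
    by_cases hin : i = n
    · obtain ⟨a, b⟩ := p
      simp only [Finset.mem_erase, Finset.mem_offDiag, Finset.mem_Icc] at hp
      grind [signedEv, adjSwap, forkRefl]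
    · simp only [hin, if_false, Finset.mem_erase] at hp ⊢
      exact signedEv_adjSwap 0 x hp.1
  exists_rep lam := by
    obtain ⟨x, hx, hx'⟩ := exists_sub_succ_eq lam n ((lam n - lam (n - 1)) / 2)
    refine ⟨x, fun i h1 hi => ?_⟩
    by_cases hin : i = n
    · subst hin
      have := hx' (i - 1) (by omega)
      rw [Nat.sub_add_cancel h1] at this
      simp only [signedEv, if_true]
      grind
    · simp only [signedEv, hin, if_false, Nat.lt_succ_self, if_true]
      exact hx' i (by omega)
  ev_pos x hx p hp := by
    obtain ⟨a, b⟩ := p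
    simp only [Finset.mem_offDiag, Finset.mem_Icc] at hp
    have hn0 : 0 < x n + x (n - 1) := by
      have := hx n (by omega) le_rfl
      simp only [signedEv, if_true] at this
      grind
    have hs : ∀ i, 1 ≤ i → i < n → 0 < x i - x (i + 1) := fun i h1 hi => by
      simpa [signedEv, hi.ne] using hx i h1 hi.le
    have hle : ∀ k l, 1 ≤ k → k ≤ l → l ≤ n → x l ≤ x k := fun k l h1 hk hl => by
      rcases hk.eq_or_lt with rfl | hk
      · exact le_rfl
      · exact (lt_of_sub_succ_pos hs h1 hk hl).le
    simp only [signedEv]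
    split_ifs with h h'
    · exact sub_pos.2 (lt_of_sub_succ_pos hs hp.1.1 h hp.2.1.2)
    · linarith [hle a n hp.1.1 hp.1.2 le_rfl, hle b (n - 1) hp.2.1.1 (by omega) (by omega)]
    · omega
  ev_nonpos x hx p hp := by
    obtain ⟨a, b⟩ := p
    simp only [Finset.mem_offDiag, Finset.mem_Icc] at hp
    have hn0 : x n + x (n - 1) ≤ 0 := by
      have := hx n (by omega) le_rfl
      simp only [signedEv, if_true] at this
      grind
    have hs : ∀ i, 1 ≤ i → i < n → x i - x (i + 1) ≤ 0 := fun i h1 hi => by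
      simpa [signedEv, hi.ne] using hx i h1 hi.le
    simp only [signedEv]
    split_ifs with h h'
    · exact sub_nonpos.2 (le_of_sub_succ_nonpos hs hp.1.1 h.le hp.2.1.2)
    · linarith [le_of_sub_succ_nonpos hs hp.1.1 hp.1.2 le_rfl,
        le_of_sub_succ_nonpos hs hp.2.1.1 (show b ≤ n - 1 by omega) (by omega)]
    · omega

/-- On a connected Dynkin diagram of finite type, every game sequence played from a
strongly dominant initial position is convergent, of length `n(n+1)/2` in type `A n`,
`n²` in types `B n` and `C n`, `n(n-1)` in type `D n`, `36`, `63`, `120`, `24`, `6`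
in types `E 6`, `E 7`, `E 8`, `F 4`, `G 2` respectively. -/
theorem finite_type_game_length (n : ℕ) (M : ℕ → ℕ → ℤ) (L : ℕ)
    (h : (1 ≤ n ∧ M = MtypeA n ∧ L = n * (n + 1) / 2) ∨
         (2 ≤ n ∧ M = MtypeB n ∧ L = n ^ 2) ∨
         (3 ≤ n ∧ M = MtypeC n ∧ L = n ^ 2) ∨
         (4 ≤ n ∧ M = MtypeD n ∧ L = n * (n - 1)) ∨
         (n = 6 ∧ M = MtypeE 6 ∧ L = 36) ∨
         (n = 7 ∧ M = MtypeE 7 ∧ L = 63) ∨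
         (n = 8 ∧ M = MtypeE 8 ∧ L = 120) ∨
         (n = 4 ∧ M = MtypeF ∧ L = 24) ∨
         (n = 2 ∧ M = MtypeG ∧ L = 6))
    (lam : ℕ → ℝ) (hdom : ∀ i, 1 ≤ i → i ≤ n → 0 < lam i) :
    (¬ ∃ f : ℕ → ℕ, DivergentSeq n M lam f) ∧
    ∀ s : List ℕ, ConvSeq n M lam s → s.length = L := by
  rcases h with ⟨-, rfl, rfl⟩ | ⟨hn, rfl, rfl⟩ | ⟨hn, rfl, rfl⟩ | ⟨hn, rfl, rfl⟩ |
    ⟨rfl, rfl, rfl⟩ | ⟨rfl, rfl, rfl⟩ | ⟨rfl, rfl, rfl⟩ | ⟨rfl, rfl, rfl⟩ | ⟨rfl, rfl, rfl⟩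
  · rw [← RootModel.card_typeA]
    exact (RootModel.typeA n).game_length hdom
  · convert (RootModel.typeB n (by omega)).game_length hdom
    simp [RootModel.typeB, RootModel.typeBC, sq]
  · convert (RootModel.typeC n (by omega)).game_length hdom
    simp [RootModel.typeC, RootModel.typeBC, sq]
  · convert (RootModel.typeD n (by omega)).game_length hdom
    simp [RootModel.typeD, Nat.mul_sub]
  · exact isRootList_E6.game_length (nodup_rootsE8.filter _) hdom
  · exact isRootList_E7.game_length (nodup_rootsE8.filter _) hdom
  · exact isRootList_E8.game_length nodup_rootsE8 hdom
  · exact isRootList_F4.game_length (by decide +kernel) hdom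
  · exact isRootList_G2.game_length (by decide +kernel) hdom
end

section
/- For every n ≥ 3, the n-cycle GCM graph in which every amplitude equals −1 is not admissible: there is no nonzero dominant position on it from which some game sequence converges. -/
/-- The `n`-cycle GCM graph on nodes `{1,…,n}` with every amplitude `-1`:
nodes `i` and `j` are adjacent exactly when `|i - j| = 1` or `{i,j} = {1,n}`. -/
def Mcycle (n : ℕ) : ℕ → ℕ → ℤ := fun i j =>
  if i = j then 2
  else if (1 ≤ i ∧ i ≤ n ∧ 1 ≤ j ∧ j ≤ n ∧ (i + 1 = j ∨ j + 1 = i)) ∨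
          (i, j) = (1, n) ∨ (i, j) = (n, 1) then -1
  else 0

/-- Each row of the cycle matrix is `2` at the node, `-1` at its two cyclic neighbours and `0`
elsewhere. -/
lemma Mcycle_eq_indicators {n i j : ℕ} (hn : 3 ≤ n) (hi : i ∈ Finset.Icc 1 n)
    (hj : j ∈ Finset.Icc 1 n) :
    Mcycle n i j = (if j = i then 2 else 0) - (if j = (if i = n then 1 else i + 1) then 1 else 0)
      - (if j = (if i = 1 then n else i - 1) then 1 else 0) := by
  simp only [Finset.mem_Icc] at hi hj
  simp only [Mcycle, Prod.mk.injEq]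
  grind

lemma sum_Mcycle_row {n i : ℕ} (hn : 3 ≤ n) (hi : i ∈ Finset.Icc 1 n) :
    ∑ j ∈ Finset.Icc 1 n, Mcycle n i j = 0 := by
  have hsucc : (if i = n then 1 else i + 1) ∈ Finset.Icc 1 n := by
    simp only [Finset.mem_Icc] at hi ⊢
    split_ifs <;> omega
  have hpred : (if i = 1 then n else i - 1) ∈ Finset.Icc 1 n := by
    simp only [Finset.mem_Icc] at hi ⊢
    split_ifs <;> omega
  rw [Finset.sum_congr rfl fun j hj => Mcycle_eq_indicators hn hi hj]
  rw [Finset.sum_sub_distrib, Finset.sum_sub_distrib, Finset.sum_ite_eq', Finset.sum_ite_eq',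
    Finset.sum_ite_eq', if_pos hi, if_pos hsucc, if_pos hpred]
  norm_num

/-- If the row of `i` sums to zero, firing `i` preserves the total of the position. -/
lemma sum_fire {M : ℕ → ℕ → ℤ} {S : Finset ℕ} {i : ℕ} (hM : ∑ j ∈ S, M i j = 0) (lam : ℕ → ℝ) :
    ∑ j ∈ S, fire M lam i j = ∑ j ∈ S, lam j := by
  simp only [fire]
  rw [Finset.sum_sub_distrib, ← Finset.sum_mul, ← Int.cast_sum, hM]
  simp

lemma sum_fireList {n : ℕ} {M : ℕ → ℕ → ℤ}
    (hM : ∀ i ∈ Finset.Icc 1 n, ∑ j ∈ Finset.Icc 1 n, M i j = 0) (s : List ℕ) :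
    ∀ lam : ℕ → ℝ, LegalSeq n M lam s →
      ∑ j ∈ Finset.Icc 1 n, fireList M lam s j = ∑ j ∈ Finset.Icc 1 n, lam j := by
  induction s with
  | nil => exact fun _ _ => rfl
  | cons i s ih =>
    rintro lam ⟨h1, h2, -, h⟩
    exact (ih _ h).trans (sum_fire (hM i (Finset.mem_Icc.2 ⟨h1, h2⟩)) lam)

/-- For every `n ≥ 3`, the `n`-cycle GCM graph with all amplitudes `-1` is not
admissible. -/
theorem cycle_not_admissible (n : ℕ) (hn : 3 ≤ n) : ¬ Admissible n (Mcycle n) := by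
  rintro ⟨lam, hdom, ⟨i, hi1, hin, hi⟩, s, hlegal, hend⟩
  have hsum := sum_fireList (fun i hi => sum_Mcycle_row hn hi) s lam hlegal
  have hpos : 0 < ∑ j ∈ Finset.Icc 1 n, lam j :=
    Finset.sum_pos' (fun j hj => hdom j (Finset.mem_Icc.1 hj).1 (Finset.mem_Icc.1 hj).2)
      ⟨i, Finset.mem_Icc.2 ⟨hi1, hin⟩, (hdom i hi1 hin).lt_of_ne' hi⟩
  have hneg : ∑ j ∈ Finset.Icc 1 n, fireList (Mcycle n) lam s j ≤ 0 :=
    Finset.sum_nonpos fun j hj => hend j (Finset.mem_Icc.1 hj).1 (Finset.mem_Icc.1 hj).2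
  linarith
end
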